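/- Let p be an odd prime, G = C × H where C ≅ C₄ and H ≅ C_p × C_p, K ∈ Sup₂^min(G_r), and 𝒜 = V(K,G). If C is an 𝒜-subgroup but H is not an 𝒜-subgroup, then 𝒜 is a nontrivial S = U/L-wreath product for some 𝒜-section S = U/L, satisfying one of the conditions (CA), (CA'), (CA''). -/

import Mathlib

open scoped Pointwise

noncomputable section

namespace Paper

/-- The element `∑_{x ∈ X} x` of the integer group ring `ℤG`. -/
def sumElems {G : Type*} [Group G] [Finite G] (X : Set G) : MonoidAlgebra ℤ G :=
  ∑ x ∈ X.toFinite.toFinset, MonoidAlgebra.single x (1 : ℤ)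

/-- A Schur ring (S-ring) over a finite group `G`, described by the partition of `G`
into its basic sets: the partition contains `{1}`, is closed under taking inverses,
and its `ℤ`-span inside the group ring `ℤG` is closed under multiplication
(hence is a subring of `ℤG`). -/
structure SRing (G : Type*) [Group G] [Finite G] where
  basic : Set (Set G)
  nonempty : ∀ X ∈ basic, X.Nonempty
  cover : ∀ g : G, ∃! X, X ∈ basic ∧ g ∈ X
  one_mem : ({1} : Set G) ∈ basic
  inv_mem : ∀ X ∈ basic, X⁻¹ ∈ basic
  mul_mem : ∀ a b : MonoidAlgebra ℤ G,
    a ∈ Submodule.span ℤ (sumElems '' basic) →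
    b ∈ Submodule.span ℤ (sumElems '' basic) →
    a * b ∈ Submodule.span ℤ (sumElems '' basic)

namespace SRing

/-- The `ℤ`-module underlying an S-ring. -/
def span {G : Type*} [Group G] [Finite G] (A : SRing G) :
    Submodule ℤ (MonoidAlgebra ℤ G) :=
  Submodule.span ℤ (sumElems '' A.basic)

/-- A set `X ⊆ G` is an `𝒜`-set if `∑_{x ∈ X} x ∈ 𝒜`. -/
def IsASet {G : Type*} [Group G] [Finite G] (A : SRing G) (X : Set G) : Prop :=
  sumElems X ∈ A.span

/-- A subgroup which is an `𝒜`-set is an `𝒜`-subgroup. -/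
def IsASubgroup {G : Type*} [Group G] [Finite G] (A : SRing G) (H : Subgroup G) : Prop :=
  A.IsASet (H : Set G)

end SRing

/-- The arc set `R(X) = {(g, xg) : x ∈ X, g ∈ G}` of the Cayley digraph `Cay(G, X)`. -/
def Rel {G : Type*} [Group G] (X : Set G) : Set (G × G) := {p | p.2 * p.1⁻¹ ∈ X}

/-- `f : G ≃ G'` is an isomorphism from the S-ring `A` over `G` to the S-ring `B`
over `G'` if `{R(X)^f : X ∈ 𝒮(A)} = {R(Y) : Y ∈ 𝒮(B)}`. -/
def IsSRingIso {G G' : Type*} [Group G] [Finite G] [Group G'] [Finite G']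
    (A : SRing G) (B : SRing G') (f : G ≃ G') : Prop :=
  (fun X => Prod.map f f '' Rel X) '' A.basic = Rel '' B.basic

/-- The automorphism group `Aut(𝒜)` of an S-ring, as a set of permutations of `G`. -/
def SRing.autSet {G : Type*} [Group G] [Finite G] (A : SRing G) : Set (Equiv.Perm G) :=
  {f | ∀ X ∈ A.basic, Prod.map f f '' Rel X = Rel X}

/-- The set `Iso(𝒜)` of isomorphisms from `𝒜` onto S-rings over the same group `G`. -/
def SRing.isoSet {G : Type*} [Group G] [Finite G] (A : SRing G) : Set (Equiv.Perm G) :=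
  {f | ∃ B : SRing G, IsSRingIso A B f}

/-- `Aut(G)` as a set of permutations of `G`. -/
def autPerm (G : Type*) [Group G] : Set (Equiv.Perm G) :=
  Set.range fun φ : G ≃* G => (φ.toEquiv : Equiv.Perm G)

/-- A CI-S-ring: `Aut(𝒜)·Aut(G) = Iso(𝒜)`. -/
def SRing.IsCI {G : Type*} [Group G] [Finite G] (A : SRing G) : Prop :=
  A.autSet * autPerm G = A.isoSet

/-- The orbits on `G` of a set of automorphisms of `G`. -/
def setOrbits {G : Type*} [Group G] (Δ : Set (MulAut G)) : Set (Set G) :=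
  Set.range fun g : G => (fun φ : MulAut G => φ g) '' Δ

/-- An S-ring is cyclotomic if its basic sets are exactly the orbits of some
subgroup `K ≤ Aut(G)`. -/
def SRing.IsCyclotomic {G : Type*} [Group G] [Finite G] (A : SRing G) : Prop :=
  ∃ K : Subgroup (MulAut G), A.basic = setOrbits (K : Set (MulAut G))

/-- `Aut_G(𝒜) = Aut(𝒜) ∩ Aut(G)`, as a set of automorphisms of `G`. -/
def SRing.autGSet {G : Type*} [Group G] [Finite G] (A : SRing G) : Set (MulAut G) :=
  {φ | (φ.toEquiv : Equiv.Perm G) ∈ A.autSet}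

/-- A (cyclotomic) S-ring is Cayley minimal if `Aut_G(𝒜)` is the only subgroup of
`Aut(G)` whose orbits on `G` coincide with those of `Aut_G(𝒜)`. -/
def SRing.IsCayleyMinimal {G : Type*} [Group G] [Finite G] (A : SRing G) : Prop :=
  ∀ K : Subgroup (MulAut G),
    setOrbits (K : Set (MulAut G)) = setOrbits A.autGSet →
    (K : Set (MulAut G)) = A.autGSet

/-- `rad(X) = {g ∈ G : gX = Xg = X}`. -/
def rad {G : Type*} [Group G] (X : Set G) : Set G := {g | {g} * X = X ∧ X * {g} = X}

/-- The class `𝓔_c` of finite abelian groups all of whose Sylow subgroups are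
elementary abelian or isomorphic to `C₄`. -/
def InEc (G : Type*) [CommGroup G] [Finite G] : Prop :=
  ∀ p : ℕ, p.Prime → ∀ P : Sylow p G,
    (∀ x : ↥(P : Subgroup G), x ^ p = 1) ∨
    Nonempty (↥(P : Subgroup G) ≃* Multiplicative (ZMod 4))

/-- A finite group `G` is a `DCI`-group if any two Cayley digraphs over `G` that are
isomorphic as digraphs are Cayley isomorphic. -/
def IsDCIGroup (G : Type*) [Group G] : Prop :=
  ∀ S T : Set G,
    (∃ f : G ≃ G, ∀ g h : G, h * g⁻¹ ∈ S ↔ f h * (f g)⁻¹ ∈ T) →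
    ∃ φ : G ≃* G, ⇑φ '' S = T

/-- The subgroup `G_r ≤ Sym(G)` of right translations of `G`. -/
def rightTranslations (G : Type*) [Group G] : Subgroup (Equiv.Perm G) where
  carrier := Set.range fun g : G => Equiv.mulRight g
  one_mem' := ⟨1, by ext x; simp⟩
  mul_mem' := by
    rintro _ _ ⟨a, rfl⟩ ⟨b, rfl⟩
    exact ⟨b * a, by ext x; simp [mul_assoc]⟩
  inv_mem' := by
    rintro _ ⟨a, rfl⟩
    exact ⟨a⁻¹, by ext x; simp⟩

/-- The basic sets of the S-ring `V(K, G)`: the orbits of the stabilizer `K_e`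
of the identity on `G`. -/
def VBasic {G : Type*} [Group G] (K : Subgroup (Equiv.Perm G)) : Set (Set G) :=
  Set.range fun g : G => MulAction.orbit (MulAction.stabilizer K (1 : G)) g

/-- A subgroup `R ≤ Sym(G)` is regular if for all `g, h ∈ G` there is a
unique `r ∈ R` with `r(g) = h`. -/
def IsRegularSubgroup {G : Type*} [Group G] (R : Subgroup (Equiv.Perm G)) : Prop :=
  ∀ g h : G, ∃! r : R, (r : Equiv.Perm G) g = h

/-- `K ∈ Sup(G_r)`. -/
def InSup {G : Type*} [Group G] (K : Subgroup (Equiv.Perm G)) : Prop :=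
  rightTranslations G ≤ K

/-- `K ∈ Sup₂(G_r)`, i.e. `K ≥ G_r` and `K = K^{(2)} = Aut(V(K,G))`. -/
def InSup2 {G : Type*} [Group G] [Finite G] (K : Subgroup (Equiv.Perm G)) : Prop :=
  InSup K ∧
    (K : Set (Equiv.Perm G)) =
      {f : Equiv.Perm G | ∀ X ∈ VBasic K, Prod.map (⇑f) (⇑f) '' Rel X = Rel X}

/-- `K₁ ⪯_G K₂`: `K₁ ≤ K₂` and every regular subgroup of `K₂` isomorphic to `G`
is conjugate in `K₂` to a subgroup of `K₁`. -/
def GComplete {G : Type*} [Group G] (K₁ K₂ : Subgroup (Equiv.Perm G)) : Prop :=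
  K₁ ≤ K₂ ∧ ∀ R : Subgroup (Equiv.Perm G), R ≤ K₂ → IsRegularSubgroup R →
    Nonempty (↥R ≃* G) → ∃ k ∈ K₂, ∀ r ∈ R, k * r * k⁻¹ ∈ K₁

/-- `K ∈ Sup₂^min(G_r)`: a minimal element of `Sup₂(G_r)` with respect to `⪯_G`. -/
def InSup2Min {G : Type*} [Group G] [Finite G] (K : Subgroup (Equiv.Perm G)) : Prop :=
  InSup2 K ∧ ∀ K' : Subgroup (Equiv.Perm G), InSup2 K' → GComplete K' K → K' = K

/-- The basic sets of the restriction `𝒜_U` of `𝒜` to an `𝒜`-subgroup `U`: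
the basic sets of `𝒜` contained in `U`, viewed inside `U`. -/
def restrictBasic {G : Type*} [Group G] [Finite G] (A : SRing G) (U : Subgroup G) :
    Set (Set ↥U) :=
  {Y : Set ↥U | Subtype.val '' Y ∈ A.basic}

/-- The basic sets of the quotient S-ring `𝒜_{G/L}`: the images of the basic
sets of `𝒜` under the canonical epimorphism `G → G/L`. -/
def quotBasic {G : Type*} [CommGroup G] [Finite G] (A : SRing G) (L : Subgroup G) :
    Set (Set (G ⧸ L)) :=
  (fun X => QuotientGroup.mk '' X) '' A.basic

/-- The basic sets of the S-ring `𝒜_S` on the section `S = U/L`: the images under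
the canonical epimorphism `U → U/L` of the basic sets of `𝒜` contained in `U`. -/
def secBasic {G : Type*} [CommGroup G] [Finite G] (A : SRing G) (U L : Subgroup G) :
    Set (Set (↥U ⧸ L.subgroupOf U)) :=
  {Z | ∃ X ∈ A.basic, X ⊆ (U : Set G) ∧
    Z = QuotientGroup.mk '' (Subtype.val ⁻¹' X : Set ↥U)}

/-- The set of bijections of `H ⧸ N` induced by members of `Δ ⊆ Sym(H)`
permuting the `N`-cosets. -/
def inducedOnQuot {H : Type*} [CommGroup H] (N : Subgroup H) (Δ : Set (Equiv.Perm H)) :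
    Set (Equiv.Perm (H ⧸ N)) :=
  {σ | ∃ f ∈ Δ, ∀ x : H, σ (QuotientGroup.mk x) = QuotientGroup.mk (f x)}

/-- The canonical (injective) homomorphism `U/L → G/L` for `L ≤ U ≤ G`. -/
def secIncl {G : Type*} [CommGroup G] (U L : Subgroup G) :
    (↥U ⧸ L.subgroupOf U) →* G ⧸ L :=
  QuotientGroup.map (L.subgroupOf U) L U.subtype (fun _ hx => hx)

/-- The set of bijections of the section `S = U/L` induced by members of
`Δ ⊆ Sym(G/L)` preserving `S` (i.e. permuting the `L`-cosets contained in `U`). -/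
def inducedOnSec {G : Type*} [CommGroup G] (U L : Subgroup G)
    (Δ : Set (Equiv.Perm (G ⧸ L))) : Set (Equiv.Perm (↥U ⧸ L.subgroupOf U)) :=
  {σ | ∃ φ ∈ Δ, ∀ x : ↥U,
    φ (QuotientGroup.mk (x : G) : G ⧸ L) = secIncl U L (σ (QuotientGroup.mk x))}

/-- The basic sets of the S-ring `(ℤL ⊗ 𝒜_V) ≀_{(V×L)/V} ℤ(U/V)` over `U`,
where `Lu, V ≤ U` and `𝒜_V` is the restriction of `𝒜_U` to `V`. -/
def tensorWreathBasic {U : Type*} [CommGroup U] [Finite U] (AU : SRing U)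
    (Lu V : Subgroup U) : Set (Set U) :=
  {Z | (∃ l ∈ Lu, ∃ X ∈ AU.basic, X ⊆ (V : Set U) ∧ Z = l • X) ∨
       (∃ u : U, u ∉ Lu ⊔ V ∧ Z = u • (V : Set U))}

/-- Condition (CA): `𝒜_S = ℤS`. -/
def CondCA {G : Type*} [CommGroup G] [Finite G] (A : SRing G) (U L : Subgroup G) : Prop :=
  ∀ AS : SRing (↥U ⧸ L.subgroupOf U), AS.basic = secBasic A U L →
    AS.basic = Set.range fun s => ({s} : Set (↥U ⧸ L.subgroupOf U))

/-- Condition (CA'): `𝒜_U` or `𝒜_{G/L}` is cyclotomic and `𝒜_S` is Cayley minimal. -/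
def CondCA' {G : Type*} [CommGroup G] [Finite G] (A : SRing G) (U L : Subgroup G) : Prop :=
  ((∀ AU : SRing ↥U, AU.basic = restrictBasic A U → AU.IsCyclotomic) ∨
   (∀ AQ : SRing (G ⧸ L), AQ.basic = quotBasic A L → AQ.IsCyclotomic)) ∧
  (∀ AS : SRing (↥U ⧸ L.subgroupOf U), AS.basic = secBasic A U L → AS.IsCayleyMinimal)

/-- Condition (CA''): `U ≅ C_{4p}`, `L ≅ C₂` and
`𝒜_U = (ℤL ⊗ 𝒜_V) ≀_{(V×L)/V} ℤ(U/V)` for an `𝒜_U`-subgroup `V` of order `p`. -/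
def CondCA'' {G : Type*} [CommGroup G] [Finite G] (p : ℕ) (A : SRing G)
    (U L : Subgroup G) : Prop :=
  Nat.card ↥U = 4 * p ∧ IsCyclic ↥U ∧ Nat.card ↥L = 2 ∧
  ∀ AU : SRing ↥U, AU.basic = restrictBasic A U →
    ∃ V : Subgroup ↥U, AU.IsASubgroup V ∧ Nat.card ↥V = p ∧
      AU.basic = tensorWreathBasic AU (L.subgroupOf U) V

/-- `𝒜 = 𝒜_{G₁} ⊗ 𝒜_{G₂}` for `G = G₁ × G₂` (internally). -/
def IsTensorDecomp {G : Type*} [CommGroup G] [Finite G] (A : SRing G)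
    (G₁ G₂ : Subgroup G) : Prop :=
  A.IsASubgroup G₁ ∧ A.IsASubgroup G₂ ∧ G₁ ⊓ G₂ = ⊥ ∧ G₁ ⊔ G₂ = ⊤ ∧
  A.basic = {Z | ∃ X ∈ A.basic, ∃ Y ∈ A.basic,
    X ⊆ (G₁ : Set G) ∧ Y ⊆ (G₂ : Set G) ∧ Z = X * Y}

/-- `𝒜` is the tensor product of two S-rings over proper nontrivial subgroups of `G`. -/
def TensorConclusion {G : Type*} [CommGroup G] [Finite G] (A : SRing G) : Prop :=
  ∃ G₁ G₂ : Subgroup G, G₁ ≠ ⊥ ∧ G₁ ≠ ⊤ ∧ G₂ ≠ ⊥ ∧ G₂ ≠ ⊤ ∧ IsTensorDecomp A G₁ G₂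

/-- `𝒜` is a nontrivial `S = U/L`-wreath product satisfying one of the
conditions (CA), (CA'), (CA''). -/
def WreathConclusion {G : Type*} [CommGroup G] [Finite G] (p : ℕ) (A : SRing G) : Prop :=
  ∃ U L : Subgroup G, L ≤ U ∧ A.IsASubgroup U ∧ A.IsASubgroup L ∧ L ≠ ⊥ ∧ U ≠ ⊤ ∧
    (∀ X ∈ A.basic, ¬ X ⊆ (U : Set G) → (L : Set G) ⊆ rad X) ∧
    (CondCA A U L ∨ CondCA' A U L ∨ CondCA'' p A U L)

section InvariantSets

variable {G : Type*} [CommGroup G]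

/-- The orbit of `x` under the stabilizer of the identity in `Γ`. -/
def cell (Γ : Subgroup (Equiv.Perm G)) (x : G) : Set G :=
  {y | ∃ k ∈ Γ, k 1 = 1 ∧ k x = y}

/-- A set is invariant if it is preserved by the stabilizer of the identity in `Γ`. -/
def IsInv (Γ : Subgroup (Equiv.Perm G)) (S : Set G) : Prop :=
  ∀ k ∈ Γ, k 1 = 1 → ∀ x ∈ S, k x ∈ S

variable {Γ : Subgroup (Equiv.Perm G)}

lemma mem_cell_self (x : G) : x ∈ cell Γ x := ⟨1, Γ.one_mem, rfl, rfl⟩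

lemma isInv_cell (x : G) : IsInv Γ (cell Γ x) := by
  rintro k hk hk1 _ ⟨l, hl, hl1, rfl⟩
  exact ⟨k * l, Γ.mul_mem hk hl, by simp [hl1, hk1], rfl⟩

lemma IsInv.cell_subset {S : Set G} (hS : IsInv Γ S) {x : G} (hx : x ∈ S) : cell Γ x ⊆ S := by
  rintro _ ⟨k, hk, hk1, rfl⟩
  exact hS k hk hk1 x hx

lemma mem_cell_comm {x y : G} (h : y ∈ cell Γ x) : x ∈ cell Γ y := by
  obtain ⟨k, hk, hk1, rfl⟩ := h
  exact ⟨k⁻¹, Γ.inv_mem hk, by rw [Equiv.Perm.inv_eq_iff_eq, hk1], by simp⟩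

lemma cell_eq_of_mem {x y : G} (h : y ∈ cell Γ x) : cell Γ y = cell Γ x :=
  (isInv_cell x).cell_subset h |>.antisymm ((isInv_cell y).cell_subset (mem_cell_comm h))

lemma IsInv.mem_iff {S : Set G} (hS : IsInv Γ S) {k : Equiv.Perm G} (hk : k ∈ Γ) (hk1 : k 1 = 1)
    (x : G) : k x ∈ S ↔ x ∈ S := by
  refine ⟨fun h => ?_, hS k hk hk1 x⟩
  exact hS.cell_subset h (mem_cell_comm ⟨k, hk, hk1, rfl⟩)

lemma isInv_of_cell_subset {S : Set G} (h : ∀ x ∈ S, cell Γ x ⊆ S) : IsInv Γ S :=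
  fun k hk hk1 x hx => h x hx ⟨k, hk, hk1, rfl⟩

lemma IsInv.inter {S T : Set G} (hS : IsInv Γ S) (hT : IsInv Γ T) : IsInv Γ (S ∩ T) :=
  fun k hk hk1 x hx => ⟨hS k hk hk1 x hx.1, hT k hk hk1 x hx.2⟩

lemma IsInv.diff {S T : Set G} (hS : IsInv Γ S) (hT : IsInv Γ T) : IsInv Γ (S \ T) :=
  fun k hk hk1 x hx => ⟨hS k hk hk1 x hx.1, fun h => hx.2 ((hT.mem_iff hk hk1 x).1 h)⟩

lemma IsInv.union {S T : Set G} (hS : IsInv Γ S) (hT : IsInv Γ T) : IsInv Γ (S ∪ T) :=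
  fun k hk hk1 x hx => hx.imp (hS k hk hk1 x) (hT k hk hk1 x)

lemma isInv_one : IsInv Γ ({1} : Set G) := by
  rintro k - hk1 x rfl
  exact hk1

lemma div_mem_cell (hΓ : rightTranslations G ≤ Γ) {k : Equiv.Perm G} (hk : k ∈ Γ) (a b : G) :
    k b * (k a)⁻¹ ∈ cell Γ (b * a⁻¹) := by
  refine ⟨Equiv.mulRight (k a)⁻¹ * k * Equiv.mulRight a, ?_, by simp, by simp⟩
  exact Γ.mul_mem (Γ.mul_mem (hΓ ⟨_, rfl⟩) hk) (hΓ ⟨_, rfl⟩)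

lemma IsInv.div_mem_iff {S : Set G} (hS : IsInv Γ S) (hΓ : rightTranslations G ≤ Γ)
    {k : Equiv.Perm G} (hk : k ∈ Γ) (a b : G) : k b * (k a)⁻¹ ∈ S ↔ b * a⁻¹ ∈ S :=
  ⟨fun h => hS.cell_subset h (mem_cell_comm (div_mem_cell hΓ hk a b)),
    fun h => hS.cell_subset h (div_mem_cell hΓ hk a b)⟩

lemma IsInv.mul {S T : Set G} (hΓ : rightTranslations G ≤ Γ) (hS : IsInv Γ S) (hT : IsInv Γ T) :
    IsInv Γ (S * T) := by
  rintro k hk hk1 _ ⟨s, hs, t, ht, rfl⟩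
  refine ⟨k (s * t) * (k t)⁻¹, (hS.div_mem_iff hΓ hk _ _).2 (by simpa using hs), k t,
    hT k hk hk1 t ht, by simp⟩

lemma IsInv.inv {S : Set G} (hΓ : rightTranslations G ≤ Γ) (hS : IsInv Γ S) : IsInv Γ S⁻¹ := by
  intro k hk hk1 x hx
  have := (hS.div_mem_iff hΓ hk x 1).2 (by simpa using hx)
  simpa [hk1] using this

lemma IsInv.ncard_eq {S T : Set G} (hΓ : rightTranslations G ≤ Γ) (hS : IsInv Γ S)
    (hT : IsInv Γ T) {z z' : G} (hz : z' ∈ cell Γ z) :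
    {x ∈ S | z' * x⁻¹ ∈ T}.ncard = {x ∈ S | z * x⁻¹ ∈ T}.ncard := by
  obtain ⟨k, hk, hk1, rfl⟩ := hz
  rw [← Set.ncard_image_of_injective {x ∈ S | z * x⁻¹ ∈ T} k.injective]
  congr 1
  ext y
  constructor
  · rintro ⟨hy, h⟩
    refine ⟨k⁻¹ y, ⟨?_, ?_⟩, by simp⟩
    · rw [← hS.mem_iff hk hk1]; simpa using hy
    · rw [← hT.div_mem_iff hΓ hk]; simpa using h
  · rintro ⟨x, ⟨hx, h⟩, rfl⟩
    exact ⟨hS k hk hk1 x hx, (hT.div_mem_iff hΓ hk _ _).2 h⟩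

/-- The subgroup of all `x` such that the coset `Nx` is invariant. -/
def cosetStab (Γ : Subgroup (Equiv.Perm G)) (hΓ : rightTranslations G ≤ Γ) (N : Subgroup G)
    (hN : IsInv Γ (N : Set G)) : Subgroup G where
  carrier := {x | cell Γ x ⊆ {y | y * x⁻¹ ∈ N}}
  one_mem' := fun y hy => by simpa using hN.cell_subset N.one_mem hy
  mul_mem' := by
    rintro a b ha hb _ ⟨k, hk, hk1, rfl⟩
    have h1 := div_mem_cell hΓ hk b (a * b)
    rw [mul_inv_cancel_right] at h1
    have := N.mul_mem (ha h1) (hb ⟨k, hk, hk1, rfl⟩)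
    simp only [Set.mem_ofPred_eq] at *
    convert this using 1
    rw [mul_inv]
    group
    simp [mul_comm, mul_left_comm]
  inv_mem' := by
    rintro a ha _ ⟨k, hk, hk1, rfl⟩
    have h1 := div_mem_cell hΓ hk a⁻¹ 1
    simp only [hk1, one_mul, inv_inv] at h1
    have := N.inv_mem (ha h1)
    simpa [mul_comm] using this

lemma le_cosetStab {hΓ : rightTranslations G ≤ Γ} {N : Subgroup G} {hN : IsInv Γ (N : Set G)} :
    N ≤ cosetStab Γ hΓ N hN := fun _ hx _ hy =>
  N.mul_mem (hN.cell_subset hx hy) (N.inv_mem hx)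

lemma isInv_of_le_cosetStab {hΓ : rightTranslations G ≤ Γ} {N M : Subgroup G}
    {hN : IsInv Γ (N : Set G)} (hNM : N ≤ M) (hM : M ≤ cosetStab Γ hΓ N hN) :
    IsInv Γ (M : Set G) := by
  refine isInv_of_cell_subset fun x hx y hy => ?_
  have := M.mul_mem (hNM (hM hx hy)) hx
  simpa using this

lemma apply_eq_of_mem_cosetStab_bot {hΓ : rightTranslations G ≤ Γ}
    {h : IsInv Γ ((⊥ : Subgroup G) : Set G)}
    {x : G} (hx : x ∈ cosetStab Γ hΓ ⊥ h) {k : Equiv.Perm G} (hk : k ∈ Γ) (hk1 : k 1 = 1) :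
    k x = x := by
  have := hx ⟨k, hk, hk1, rfl⟩
  simpa [mul_inv_eq_one] using this

lemma mul_inv_mem_cell_of_mem_cosetStab_bot {hΓ : rightTranslations G ≤ Γ}
    {h : IsInv Γ ((⊥ : Subgroup G) : Set G)} {s x y : G} (hs : s ∈ cosetStab Γ hΓ ⊥ h)
    (hy : y ∈ cell Γ x) : y * s⁻¹ ∈ cell Γ (x * s⁻¹) := by
  obtain ⟨k, hk, hk1, rfl⟩ := hy
  simpa [apply_eq_of_mem_cosetStab_bot hs hk hk1] using div_mem_cell hΓ hk s x

end InvariantSets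

section Minimality

/-- Sylow's theorem for the image of a homomorphism. -/
lemma exists_isPGroup_conj {p : ℕ} [Fact p.Prime] {M N : Type*} [Group M] [Finite M] [Group N]
    (φ : M →* N) (R₀ : Subgroup M) (hR₀ : IsPGroup p (R₀.map φ)) :
    ∃ P : Subgroup N, IsPGroup p P ∧ R₀.map φ ≤ P ∧
      ∀ R : Subgroup M, IsPGroup p (R.map φ) → ∃ k : M, ∀ r ∈ R, φ (k * r * k⁻¹) ∈ P := by
  have key : ∀ R : Subgroup M, IsPGroup p (R.map φ) → IsPGroup p (R.map φ.rangeRestrict) := by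
    rintro R hR ⟨_, r, hr, rfl⟩
    obtain ⟨n, hn⟩ := hR ⟨φ r, r, hr, rfl⟩
    refine ⟨n, ?_⟩
    ext
    simpa [Subtype.ext_iff] using hn
  obtain ⟨P, hP⟩ := (key R₀ hR₀).exists_le_sylow
  refine ⟨(P : Subgroup φ.range).map φ.range.subtype, P.2.map _, ?_, ?_⟩
  · rintro _ ⟨r, hr, rfl⟩
    exact ⟨φ.rangeRestrict r, hP ⟨r, hr, rfl⟩, rfl⟩
  · intro R hR
    obtain ⟨P', hP'⟩ := (key R hR).exists_le_sylow
    have : Finite φ.range := Finite.of_surjective _ φ.rangeRestrict_surjective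
    obtain ⟨⟨_, k, rfl⟩, hg⟩ := MulAction.exists_smul_eq φ.range P' P
    refine ⟨k, fun r hr => ?_⟩
    have h1 : φ.rangeRestrict r ∈ P' := hP' ⟨r, hr, rfl⟩
    refine ⟨φ.rangeRestrict (k * r * k⁻¹), ?_, rfl⟩
    rw [← hg]
    simp only [map_mul, map_inv]
    exact Subgroup.smul_mem_pointwise_smul _ _ _ h1

lemma card_eq_of_comm_of_transitive {Q : Type*} [Nonempty Q] (R : Subgroup (Equiv.Perm Q))
    (hcomm : ∀ a ∈ R, ∀ b ∈ R, a * b = b * a) (htrans : ∀ x y : Q, ∃ r ∈ R, r x = y) :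
    Nat.card R = Nat.card Q := by
  obtain ⟨q⟩ := ‹Nonempty Q›
  refine Nat.card_congr (Equiv.ofBijective (fun r : R => (r : Equiv.Perm Q) q) ⟨?_, ?_⟩)
  · rintro ⟨a, ha⟩ ⟨b, hb⟩ h
    ext x
    obtain ⟨r, hr, rfl⟩ := htrans q x
    simp only at h ⊢
    rw [← Equiv.Perm.mul_apply, ← Equiv.Perm.mul_apply, hcomm a ha r hr, hcomm b hb r hr]
    simp [h]
  · intro y
    obtain ⟨r, hr, rfl⟩ := htrans q y
    exact ⟨⟨r, hr⟩, rfl⟩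

variable {G : Type*} [CommGroup G]

lemma orbit_stabilizer_eq_cell (Γ : Subgroup (Equiv.Perm G)) (g : G) :
    MulAction.orbit (MulAction.stabilizer Γ (1 : G)) g = cell Γ g := by
  ext y
  constructor
  · rintro ⟨⟨⟨k, hk⟩, hk1⟩, rfl⟩
    exact ⟨k, hk, hk1, rfl⟩
  · rintro ⟨k, hk, hk1, rfl⟩
    exact ⟨⟨⟨k, hk⟩, hk1⟩, rfl⟩

lemma VBasic_eq_range_cell (Γ : Subgroup (Equiv.Perm G)) : VBasic Γ = Set.range (cell Γ) := by
  unfold VBasic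
  congr 1
  ext1 g
  exact orbit_stabilizer_eq_cell Γ g

/-- The `2`-closure of `Γ`. -/
def twoClosure (Γ : Subgroup (Equiv.Perm G)) : Subgroup (Equiv.Perm G) where
  carrier := {f | ∀ a b, cell Γ (f b * (f a)⁻¹) = cell Γ (b * a⁻¹)}
  one_mem' := fun _ _ => rfl
  mul_mem' := fun {f g} hf hg a b => (hf (g a) (g b)).trans (hg a b)
  inv_mem' := fun {f} hf a b => by simpa using (hf (f⁻¹ a) (f⁻¹ b)).symm

lemma mem_twoClosure_iff [Finite G] {Γ : Subgroup (Equiv.Perm G)} {f : Equiv.Perm G} :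
    f ∈ twoClosure Γ ↔ ∀ X ∈ VBasic Γ, Prod.map f f '' Rel X = Rel X := by
  rw [VBasic_eq_range_cell]
  constructor
  · rintro hf _ ⟨g, rfl⟩
    refine Set.eq_of_subset_of_ncard_le ?_ ?_ (Set.toFinite _)
    · rintro _ ⟨⟨a, b⟩, hab, rfl⟩
      change f b * (f a)⁻¹ ∈ cell Γ g
      rw [← cell_eq_of_mem hab, ← hf a b]
      exact mem_cell_self _
    · rw [Set.ncard_image_of_injective _ (f.injective.prodMap f.injective)]
  · intro h a b
    have : (f a, f b) ∈ Rel (cell Γ (b * a⁻¹)) := by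
      rw [← h _ ⟨b * a⁻¹, rfl⟩]
      exact ⟨(a, b), mem_cell_self _, rfl⟩
    exact cell_eq_of_mem this

lemma le_twoClosure {Γ : Subgroup (Equiv.Perm G)} (hΓ : rightTranslations G ≤ Γ) :
    Γ ≤ twoClosure Γ := fun _ hf a b => cell_eq_of_mem (div_mem_cell hΓ hf a b)

lemma cell_twoClosure {Γ : Subgroup (Equiv.Perm G)} (hΓ : rightTranslations G ≤ Γ) :
    cell (twoClosure Γ) = cell Γ := by
  ext g y
  constructor
  · rintro ⟨k, hk, hk1, rfl⟩
    have := hk 1 g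
    simp only [hk1, inv_one, mul_one] at this
    rw [← this]
    exact mem_cell_self _
  · rintro ⟨k, hk, hk1, rfl⟩
    exact ⟨k, le_twoClosure hΓ hk, hk1, rfl⟩

lemma inSup2_twoClosure [Finite G] {Γ : Subgroup (Equiv.Perm G)} (hΓ : rightTranslations G ≤ Γ) :
    InSup2 (twoClosure Γ) := by
  refine ⟨hΓ.trans (le_twoClosure hΓ), ?_⟩
  ext f
  rw [VBasic_eq_range_cell, cell_twoClosure hΓ, ← VBasic_eq_range_cell]
  exact mem_twoClosure_iff

lemma InSup2.twoClosure_eq [Finite G] {K : Subgroup (Equiv.Perm G)} (hK : InSup2 K) :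
    twoClosure K = K := by
  ext f
  rw [mem_twoClosure_iff]
  exact (Set.ext_iff.1 hK.2 f).symm

lemma twoClosure_mono {Γ K : Subgroup (Equiv.Perm G)} (h : Γ ≤ K) :
    twoClosure Γ ≤ twoClosure K := by
  intro f hf a b
  have : f b * (f a)⁻¹ ∈ cell Γ (b * a⁻¹) := by
    rw [← hf a b]; exact mem_cell_self _
  obtain ⟨k, hk, hk1, hk2⟩ := this
  exact cell_eq_of_mem ⟨k, h hk, hk1, hk2⟩

/-- A subgroup preserved up to conjugacy of regular subgroups determines the same cells. -/
lemma InSup2Min.cell_eq [Finite G] {K Γ : Subgroup (Equiv.Perm G)} (hK : InSup2Min K)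
    (hΓ : rightTranslations G ≤ Γ) (hΓK : Γ ≤ K)
    (hconj : ∀ R : Subgroup (Equiv.Perm G), R ≤ K → IsRegularSubgroup R →
      Nonempty (↥R ≃* G) → ∃ k ∈ K, ∀ r ∈ R, k * r * k⁻¹ ∈ Γ) : cell Γ = cell K := by
  have := hK.2 (twoClosure Γ) (inSup2_twoClosure hΓ)
    ⟨(twoClosure_mono hΓK).trans hK.1.twoClosure_eq.le, fun R h1 h2 h3 => by
      obtain ⟨k, hk, h⟩ := hconj R h1 h2 h3
      exact ⟨k, hk, fun r hr => le_twoClosure hΓ (h r hr)⟩⟩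
  rw [← this, cell_twoClosure hΓ]

/-- The permutations of the cosets of an invariant subgroup `C` induced by `Γ`. -/
def quotPerm (Γ : Subgroup (Equiv.Perm G)) (hΓ : rightTranslations G ≤ Γ) (C : Subgroup G)
    (hC : IsInv Γ (C : Set G)) : Γ →* Equiv.Perm (G ⧸ C) :=
  letI : MulAction Γ (G ⧸ C) :=
    { smul := fun k => Quotient.map' (k : Equiv.Perm G) fun a b h => by
        rw [QuotientGroup.leftRel_apply] at h ⊢
        rw [mul_comm] at h ⊢
        exact (hC.div_mem_iff hΓ k.2 a b).2 h
      one_smul := by rintro ⟨x⟩; rfl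
      mul_smul := by rintro a b ⟨x⟩; rfl }
  MulAction.toPermHom Γ (G ⧸ C)

end Minimality

section PGroupAction

variable {G : Type*} [CommGroup G]

lemma isPGroup_map_quotPerm {p n : ℕ} [Fact p.Prime] {K : Subgroup (Equiv.Perm G)}
    {hK : rightTranslations G ≤ K} {C : Subgroup G} {hC : IsInv K (C : Set G)}
    (hn : Nat.card (G ⧸ C) = p ^ n) {R : Subgroup (Equiv.Perm G)} (hRK : R ≤ K)
    (hcomm : ∀ a ∈ R, ∀ b ∈ R, a * b = b * a) (htrans : ∀ x y : G, ∃ r ∈ R, r x = y) :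
    IsPGroup p ((R.subgroupOf K).map (quotPerm K hK C hC)) := by
  refine IsPGroup.of_card (n := n) ?_
  rw [← hn]
  refine card_eq_of_comm_of_transitive _ ?_ ?_
  · rintro _ ⟨a, ha, rfl⟩ _ ⟨b, hb, rfl⟩
    rw [← map_mul, ← map_mul]
    congr 1
    exact Subtype.ext (hcomm a ha b hb)
  · rintro ⟨x⟩ ⟨y⟩
    obtain ⟨r, hr, rfl⟩ := htrans x y
    exact ⟨_, ⟨⟨r, hRK hr⟩, hr, rfl⟩, rfl⟩

variable [Finite G]

/-- By minimality, the action on the cosets of an invariant subgroup of prime power index may be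
taken to be that of a `p`-group. -/
lemma InSup2Min.exists_isPGroup_quotPerm {p n : ℕ} [Fact p.Prime] {K : Subgroup (Equiv.Perm G)}
    (hK : InSup2Min K) {C : Subgroup G} (hC : IsInv K (C : Set G))
    (hn : Nat.card (G ⧸ C) = p ^ n) :
    ∃ (Γ : Subgroup (Equiv.Perm G)) (hΓ : rightTranslations G ≤ Γ) (hCΓ : IsInv Γ (C : Set G)),
      cell Γ = cell K ∧ IsPGroup p (quotPerm Γ hΓ C hCΓ).range := by
  have hKr : rightTranslations G ≤ K := hK.1.1
  obtain ⟨P, hP, hrP, hconj⟩ := exists_isPGroup_conj (quotPerm K hKr C hC)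
    ((rightTranslations G).subgroupOf K) <| by
      refine isPGroup_map_quotPerm hn hKr ?_ ?_
      · rintro _ ⟨a, rfl⟩ _ ⟨b, rfl⟩
        ext x
        simp [mul_right_comm]
      · exact fun x y => ⟨_, ⟨x⁻¹ * y, rfl⟩, by simp⟩
  have hle : (P.comap (quotPerm K hKr C hC)).map K.subtype ≤ K := Subgroup.map_subtype_le _
  have hr : rightTranslations G ≤ (P.comap (quotPerm K hKr C hC)).map K.subtype :=
    fun f hf => ⟨⟨f, hKr hf⟩, hrP ⟨⟨f, hKr hf⟩, hf, rfl⟩, rfl⟩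
  refine ⟨_, hr, fun k hk => hC k (hle hk), hK.cell_eq hr hle ?_, ?_⟩
  · rintro R hRK hreg ⟨e⟩
    obtain ⟨k, hk⟩ := hconj (R.subgroupOf K) <| by
      refine isPGroup_map_quotPerm hn hRK ?_ ?_
      · intro a ha b hb
        have : (⟨a, ha⟩ : R) * ⟨b, hb⟩ = ⟨b, hb⟩ * ⟨a, ha⟩ :=
          e.injective (by rw [map_mul, map_mul, mul_comm])
        exact congrArg Subtype.val this
      · intro x y
        obtain ⟨r, hr, -⟩ := hreg x y
        exact ⟨r, r.2, hr⟩
    exact ⟨k, k.2, fun r hr => ⟨_, hk ⟨r, hRK hr⟩ hr, rfl⟩⟩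
  · refine hP.to_le ?_
    rintro _ ⟨⟨_, ⟨k, hk, rfl⟩⟩, rfl⟩
    have hk' : quotPerm K hKr C hC k ∈ P := hk
    convert hk' using 1
    ext ⟨x⟩
    rfl

variable {p : ℕ} [Fact p.Prime] {Γ : Subgroup (Equiv.Perm G)} {hΓ : rightTranslations G ≤ Γ}
  {C : Subgroup G} {hC : IsInv Γ (C : Set G)}

omit [Finite G] [Fact p.Prime] in
lemma isPGroup_stabilizer (hP : IsPGroup p (quotPerm Γ hΓ C hC).range) :
    IsPGroup p ((MulAction.stabilizer Γ (1 : G)).map (quotPerm Γ hΓ C hC)) :=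
  hP.to_le (by rintro _ ⟨k, -, rfl⟩; exact ⟨k, rfl⟩)

lemma exists_ncard_mul_cell (hP : IsPGroup p (quotPerm Γ hΓ C hC).range) (g : G) :
    ∃ a, ((C : Set G) * cell Γ g).ncard = Nat.card C * p ^ a := by
  obtain ⟨a, ha⟩ := (isPGroup_stabilizer hP).card_orbit (QuotientGroup.mk g : G ⧸ C)
  refine ⟨a, ?_⟩
  rw [mul_comm (C : Set G), ← QuotientGroup.preimage_image_mk_eq_mul, ← Nat.card_coe_set_eq,
    Nat.card_congr (QuotientGroup.preimageMkEquivSubgroupProdSet _ _), Nat.card_prod, ← ha]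
  congr 2
  have : (QuotientGroup.mk '' cell Γ g : Set (G ⧸ C)) = MulAction.orbit
      ((MulAction.stabilizer Γ (1 : G)).map (quotPerm Γ hΓ C hC)) (QuotientGroup.mk g) := by
    ext q
    constructor
    · rintro ⟨_, ⟨k, hk, hk1, rfl⟩, rfl⟩
      exact ⟨⟨_, ⟨⟨k, hk⟩, hk1, rfl⟩⟩, rfl⟩
    · rintro ⟨⟨_, ⟨⟨k, hk⟩, hk1, rfl⟩⟩, rfl⟩
      exact ⟨_, ⟨k, hk, hk1, rfl⟩, rfl⟩
  rw [this]

lemma exists_mem_cosetStab (hP : IsPGroup p (quotPerm Γ hΓ C hC).range)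
    (hp : p ∣ Nat.card (G ⧸ C)) : ∃ x ∈ cosetStab Γ hΓ C hC, x ∉ C := by
  have hS := isPGroup_stabilizer hP
  obtain ⟨⟨x⟩, hx, hne⟩ := hS.exists_fixed_point_of_prime_dvd_card_of_fixed_point (G ⧸ C) hp
    (a := QuotientGroup.mk 1) <| by
      rintro ⟨_, ⟨⟨k, hk⟩, hk1, rfl⟩⟩
      change (QuotientGroup.mk (k 1) : G ⧸ C) = _
      rw [show k 1 = 1 from hk1]
  refine ⟨x, ?_, fun h => hne ?_⟩
  · rintro _ ⟨k, hk, hk1, rfl⟩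
    have : (QuotientGroup.mk (k x) : G ⧸ C) = QuotientGroup.mk x := hx ⟨_, ⟨⟨k, hk⟩, hk1, rfl⟩⟩
    simpa [mul_comm] using QuotientGroup.eq.1 this.symm
  · exact QuotientGroup.eq.2 (by simpa using h)

end PGroupAction

section CosetSets

variable {G : Type*} [CommGroup G]

/-- The union of the cosets `N (c e) g` for `e ∈ E`. -/
def cosetUnion (N : Subgroup G) (c : Multiplicative (ZMod 4) →* G)
    (E : Finset (Multiplicative (ZMod 4))) (g : G) : Set G :=
  {x | ∃ e ∈ E, x * (c e * g)⁻¹ ∈ N}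

variable {N : Subgroup G} {c : Multiplicative (ZMod 4) →* G}
  {E F : Finset (Multiplicative (ZMod 4))} {g h : G}

lemma cosetUnion_mul :
    cosetUnion N c E g * cosetUnion N c F h = cosetUnion N c (E * F) (g * h) := by
  ext x
  constructor
  · rintro ⟨a, ⟨e, he, ha⟩, b, ⟨f, hf, hb⟩, rfl⟩
    refine ⟨e * f, Finset.mul_mem_mul he hf, ?_⟩
    convert N.mul_mem ha hb using 1
    simp only [map_mul, mul_inv]
    ac_rfl
  · rintro ⟨_, hef, hx⟩
    obtain ⟨e, he, f, hf, rfl⟩ := Finset.mem_mul.1 hef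
    refine ⟨x * (c f * h)⁻¹, ⟨e, he, ?_⟩, c f * h, ⟨f, hf, by simp⟩, inv_mul_cancel_right _ _⟩
    convert hx using 1
    simp only [map_mul, mul_inv]
    ac_rfl

lemma cosetUnion_inv : (cosetUnion N c E g)⁻¹ = cosetUnion N c E⁻¹ g⁻¹ := by
  have key : ∀ (E : Finset (Multiplicative (ZMod 4))) (g x : G),
      x⁻¹ ∈ cosetUnion N c E g → x ∈ cosetUnion N c E⁻¹ g⁻¹ := by
    rintro E g x ⟨e, he, hx⟩
    refine ⟨e⁻¹, Finset.inv_mem_inv he, ?_⟩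
    convert N.inv_mem hx using 1
    simp [mul_comm]
  ext x
  refine ⟨key E g x, fun hx => ?_⟩
  have := key E⁻¹ g⁻¹ x⁻¹ (by simpa using hx)
  simpa using this

lemma eq_of_mem_cosets (hc : ∀ e, c e ∈ N → e = 1) {e f : Multiplicative (ZMod 4)} {x : G}
    (he : x * (c e * g)⁻¹ ∈ N) (hf : x * (c f * g)⁻¹ ∈ N) : e = f := by
  rw [← mul_inv_eq_one]
  refine hc _ ?_
  convert N.mul_mem (N.inv_mem he) hf using 1
  simp

lemma cosetUnion_sdiff (hc : ∀ e, c e ∈ N → e = 1) :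
    cosetUnion N c E g \ cosetUnion N c F g = cosetUnion N c (E \ F) g := by
  ext x
  constructor
  · rintro ⟨⟨e, he, h1⟩, h2⟩
    exact ⟨e, Finset.mem_sdiff.2 ⟨he, fun hf => h2 ⟨e, hf, h1⟩⟩, h1⟩
  · rintro ⟨e, he, h1⟩
    refine ⟨⟨e, (Finset.mem_sdiff.1 he).1, h1⟩, ?_⟩
    rintro ⟨f, hf, h2⟩
    obtain rfl := eq_of_mem_cosets hc h1 h2
    exact (Finset.mem_sdiff.1 he).2 hf

/-- The element of order two of the cyclic group of order four. -/
def invol : Multiplicative (ZMod 4) := Multiplicative.ofAdd 2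

lemma mem_zpowers_invol {x : G} :
    x ∈ Subgroup.zpowers (c invol) ↔ x = 1 ∨ x = c invol := by
  constructor
  · rintro ⟨n, rfl⟩
    have h : c invol ^ (2 : ℤ) = 1 := by
      rw [← map_zpow, show invol ^ (2 : ℤ) = 1 from rfl, map_one]
    obtain ⟨k, rfl | rfl⟩ := Int.even_or_odd' n
    · left; simp [zpow_mul, h]
    · right; simp [zpow_add, zpow_mul, h]
  · rintro (rfl | rfl)
    · exact one_mem _
    · exact Subgroup.mem_zpowers _

variable {Γ : Subgroup (Equiv.Perm G)} {hΓ : rightTranslations G ≤ Γ}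

lemma mem_cosetStab_of_isInv {hN : IsInv Γ (N : Set G)} {e : Multiplicative (ZMod 4)}
    (h : IsInv Γ (cosetUnion N c {e} g)) : c e * g ∈ cosetStab Γ hΓ N hN := by
  intro y hy
  obtain ⟨f, hf, h⟩ := h.cell_subset ⟨e, Finset.mem_singleton_self e, by simp⟩ hy
  rwa [Finset.mem_singleton.1 hf] at h

lemma exists_cosetUnion_eq (hy : cell Γ g ⊆ cosetUnion N c Finset.univ g) :
    ∃ E, 1 ∈ E ∧ (N : Set G) * cell Γ g = cosetUnion N c E g := by
  classical
  refine ⟨Finset.univ.filter fun e => c e * g ∈ (N : Set G) * cell Γ g, ?_, ?_⟩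
  · simpa using ⟨1, N.one_mem, g, mem_cell_self g, by simp⟩
  · ext x
    constructor
    · rintro ⟨n, hn, y, hy', rfl⟩
      obtain ⟨e, -, he⟩ := hy hy'
      refine ⟨e, ?_, ?_⟩
      · simp only [Finset.mem_filter, Finset.mem_univ, true_and]
        refine ⟨_, N.inv_mem he, y, hy', by simp⟩
      · simp only
        rw [mul_assoc]
        exact N.mul_mem hn he
    · rintro ⟨e, he, h⟩
      simp only [Finset.mem_filter, Finset.mem_univ, true_and] at he
      obtain ⟨n, hn, y, hy', h'⟩ := he
      refine ⟨_, N.mul_mem h hn, y, hy', ?_⟩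
      simp only at h' ⊢
      rw [mul_assoc, h', inv_mul_cancel_right]

lemma exists_pow_eq_singleton_of_invol (E : Finset (Multiplicative (ZMod 4))) (h1 : 1 ∈ E)
    (h : (E ∩ ({invol} * E)).Nonempty → E ⊆ {invol} * E) :
    {invol} * E = E ∨ E = {1} ∨ ∃ e, (E * E) \ ({invol} * (E * E)) = {e} := by
  revert E
  decide

lemma exists_singleton_or_invol (E : Finset (Multiplicative (ZMod 4))) (h1 : 1 ∈ E) :
    E = Finset.univ ∨ (∃ e, E = {e} ∨ Finset.univ \ E = {e}) ∨
      E * E⁻¹ = {1, invol} ∨ Finset.univ \ (E * E⁻¹) = {invol} := by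
  revert E
  decide

/-- The least nontrivial invariant subgroup of an invariant cyclic group of order four. -/
def IsLeast4 (Γ : Subgroup (Equiv.Perm G)) (c : Multiplicative (ZMod 4) →* G)
    (D : Subgroup G) : Prop :=
  (D = Subgroup.zpowers (c invol) ∧ IsInv Γ (D : Set G)) ∨
    (D = c.range ∧ ¬ IsInv Γ (Subgroup.zpowers (c invol) : Set G))

variable {D : Subgroup G}

lemma IsLeast4.isInv (hD : IsLeast4 Γ c D) (hC : IsInv Γ (c.range : Set G)) :
    IsInv Γ (D : Set G) := by
  rcases hD with ⟨-, h⟩ | ⟨rfl, -⟩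
  exacts [h, hC]

lemma IsLeast4.le (hD : IsLeast4 Γ c D) : D ≤ c.range := by
  rcases hD with ⟨rfl, -⟩ | ⟨rfl, -⟩
  · rw [Subgroup.zpowers_le]
    exact ⟨_, rfl⟩
  · exact le_rfl

lemma IsLeast4.invol_mem (hD : IsLeast4 Γ c D) : c invol ∈ D := by
  rcases hD with ⟨rfl, -⟩ | ⟨rfl, -⟩
  exacts [Subgroup.mem_zpowers _, ⟨_, rfl⟩]

lemma IsLeast4.mul_inv_mem (hD : IsLeast4 Γ c D) (hC : IsInv Γ (c.range : Set G)) {x y : G}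
    (hx : x ∈ c.range) (hy : y ∈ cell Γ x) : x⁻¹ * y ∈ D := by
  have hyC := hC.cell_subset hx hy
  rcases hD with ⟨rfl, hD⟩ | ⟨rfl, -⟩
  · obtain ⟨a, rfl⟩ := hx
    obtain ⟨b, rfl⟩ := hyC
    by_cases ha : c a ∈ Subgroup.zpowers (c invol)
    · exact mul_mem (inv_mem ha) (hD.cell_subset ha hy)
    · have hb : c b ∉ Subgroup.zpowers (c invol) :=
        fun hb => ha (hD.cell_subset hb (mem_cell_comm hy))
      have key : ∀ a b : Multiplicative (ZMod 4), a = 1 ∨ a = invol ∨ b = 1 ∨ b = invol ∨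
          a⁻¹ * b = 1 ∨ a⁻¹ * b = invol := by decide
      rw [mem_zpowers_invol] at ha hb ⊢
      push Not at ha hb
      rw [← map_inv, ← map_mul]
      rcases key a b with h | h | h | h | h | h
      · simp [h] at ha
      · simp [h] at ha
      · simp [h] at hb
      · simp [h] at hb
      · simp [h]
      · simp [h]
  · exact mul_mem (inv_mem hx) hyC

/-- If the cell of `g` lies in `NCg`, then modulo `N` it is stable under the least nontrivial
invariant subgroup of `C`, unless it contains a coset of `N` with an invariant power. -/
lemma IsLeast4.mul_mem_or_pow_mem (hD : IsLeast4 Γ c D) (hN : IsInv Γ (N : Set G))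
    (hc : ∀ e, c e ∈ N → e = 1) (hC : IsInv Γ (c.range : Set G))
    (hg : cell Γ g ⊆ cosetUnion N c Finset.univ g) :
    (∀ d ∈ D, ∀ x ∈ (N : Set G) * cell Γ g, d * x ∈ (N : Set G) * cell Γ g) ∨
      g ^ 8 ∈ cosetStab Γ hΓ N hN := by
  obtain ⟨E, h1, hE⟩ := exists_cosetUnion_eq hg
  have hEinv : IsInv Γ (cosetUnion N c E g) := hE ▸ hN.mul hΓ (isInv_cell g)
  have hmin : ∀ F, IsInv Γ (cosetUnion N c F g) → (E ∩ F).Nonempty → E ⊆ F := by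
    rintro F hF ⟨e, he⟩
    rw [Finset.mem_inter] at he
    obtain ⟨n, hn, y, hy, hny⟩ : c e * g ∈ (N : Set G) * cell Γ g := by
      rw [hE]; exact ⟨e, he.1, by simp⟩
    have hy' : y ∈ cosetUnion N c F g := by
      refine ⟨e, he.2, ?_⟩
      simp only at hny
      rw [← hny]
      simpa using hn
    have hgF := hF.cell_subset hy' (mem_cell_comm hy)
    intro f hf
    obtain ⟨n, hn, y, hy, hny⟩ : c f * g ∈ (N : Set G) * cell Γ g := by
      rw [hE]; exact ⟨f, hf, by simp⟩
    obtain ⟨f', hf', h⟩ := hF.cell_subset hgF hy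
    obtain rfl : f = f' := by
      refine eq_of_mem_cosets (g := g) (x := y) hc ?_ h
      simp only at hny
      rw [← hny]
      simpa using hn
    exact hf'
  have hpow : ∀ e k, IsInv Γ (cosetUnion N c {e} (g ^ k)) → k ∣ 2 →
      g ^ 8 ∈ cosetStab Γ hΓ N hN := by
    rintro e k h ⟨l, hl⟩
    have h' := Subgroup.pow_mem _ (mem_cosetStab_of_isInv (hΓ := hΓ) (hN := hN) h) (4 * l)
    have he : e ^ 4 = 1 := (by decide : ∀ e : Multiplicative (ZMod 4), e ^ 4 = 1) e
    rw [mul_pow, ← map_pow, pow_mul, he, one_pow, map_one, one_mul, ← pow_mul] at h'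
    rwa [mul_left_comm, ← hl] at h'
  have hC1 : IsInv Γ (cosetUnion N c Finset.univ 1) := by
    convert hN.mul hΓ hC using 1
    ext x
    constructor
    · rintro ⟨e, -, h⟩
      exact ⟨_, h, c e, ⟨e, rfl⟩, by simp⟩
    · rintro ⟨n, hn, _, ⟨e, rfl⟩, rfl⟩
      exact ⟨e, Finset.mem_univ e, by simpa using hn⟩
  have hstab : ∀ e, {e} * E = E → ∀ x ∈ (N : Set G) * cell Γ g,
      c e * x ∈ (N : Set G) * cell Γ g := by
    intro e he x hx
    rw [hE] at hx ⊢
    obtain ⟨f, hf, h⟩ := hx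
    refine ⟨e * f, by rw [← he]; exact Finset.mul_mem_mul (by simp) hf, ?_⟩
    convert h using 1
    rw [map_mul, mul_assoc (c e) (c f), mul_inv (c e), mul_mul_mul_comm, mul_inv_cancel, one_mul]
  rcases hD with ⟨rfl, hD⟩ | ⟨rfl, hD⟩
  · have hd : IsInv Γ (cosetUnion N c {invol} 1) := by
      convert hN.mul hΓ (hD.diff isInv_one) using 1
      ext x
      constructor
      · rintro ⟨e, he, h⟩
        obtain rfl := Finset.mem_singleton.1 he
        refine ⟨_, h, c invol, ⟨Subgroup.mem_zpowers _, fun h => ?_⟩, by simp⟩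
        exact absurd (hc invol ((Set.mem_singleton_iff.1 h) ▸ N.one_mem)) (by decide)
      · rintro ⟨n, hn, y, ⟨hy, hy1⟩, rfl⟩
        obtain rfl | rfl := mem_zpowers_invol.1 hy
        · exact absurd rfl hy1
        · exact ⟨invol, Finset.mem_singleton_self _, by simpa using hn⟩
    have hdE : IsInv Γ (cosetUnion N c ({invol} * E) g) := by
      rw [← one_mul g, ← cosetUnion_mul]
      exact hd.mul hΓ hEinv
    rcases exists_pow_eq_singleton_of_invol E h1 (hmin _ hdE) with h | h | ⟨e, h⟩
    · left
      intro d hd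
      rw [mem_zpowers_invol] at hd
      rcases hd with rfl | rfl
      · simp
      · exact hstab _ h
    · exact Or.inr (hpow 1 1 (by rwa [pow_one, ← h]) (by norm_num))
    · refine Or.inr (hpow e 2 ?_ dvd_rfl)
      rw [← h, ← cosetUnion_sdiff hc]
      have h2 : IsInv Γ (cosetUnion N c (E * E) (g ^ 2)) := by
        rw [pow_two, ← cosetUnion_mul]
        exact hEinv.mul hΓ hEinv
      refine h2.diff ?_
      rw [← one_mul (g ^ 2), ← cosetUnion_mul]
      exact hd.mul hΓ h2
  · have hcontra : ∀ F, invol ∈ F → F ⊆ {1, invol} → ¬ IsInv Γ (cosetUnion N c F 1) := by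
      intro F hF hF' h
      refine hD ?_
      convert (isInv_one (Γ := Γ)).union (h.inter hC) using 1
      ext x
      rw [SetLike.mem_coe, mem_zpowers_invol, Set.mem_union, Set.mem_singleton_iff]
      constructor
      · rintro (rfl | rfl)
        · exact Or.inl rfl
        · exact Or.inr ⟨⟨invol, hF, by simp⟩, invol, rfl⟩
      · rintro (rfl | ⟨⟨f, hf, hx⟩, e, rfl⟩)
        · exact Or.inl rfl
        · have h' : e = f := eq_of_mem_cosets (g := 1) (x := c e) hc (by simp) hx
          obtain rfl | h' := Finset.mem_insert.1 (hF' (h' ▸ hf))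
          · exact Or.inl (map_one c)
          · exact Or.inr (by rw [Finset.mem_singleton.1 h'])
    have hEE : IsInv Γ (cosetUnion N c (E * E⁻¹) 1) := by
      rw [← mul_inv_cancel g, ← cosetUnion_mul, ← cosetUnion_inv]
      exact hEinv.mul hΓ (hEinv.inv hΓ)
    rcases exists_singleton_or_invol E h1 with h | ⟨e, h | h⟩ | h | h
    · left
      rintro _ ⟨e, rfl⟩
      exact hstab e (by rw [h]; revert e; decide)
    · exact Or.inr (hpow e 1 (by rwa [pow_one, ← h]) (by norm_num))
    · refine Or.inr (hpow e 1 ?_ (by norm_num))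
      rw [← h, ← cosetUnion_sdiff hc, pow_one]
      refine IsInv.diff ?_ hEinv
      have h2 := hC1.mul hΓ hEinv
      rwa [cosetUnion_mul, one_mul, show Finset.univ * E = Finset.univ by
        revert h1; clear * -; revert E; decide] at h2
    · exact absurd hEE (hcontra _ (by simp [h]) h.le)
    · refine absurd (hC1.diff hEE) ?_
      rw [cosetUnion_sdiff hc, h]
      exact hcontra _ (by simp) (by simp)

end CosetSets

section Structure

variable {G : Type*} [CommGroup G] [Finite G] {p : ℕ} {Γ : Subgroup (Equiv.Perm G)}
  {c : Multiplicative (ZMod 4) →* G} {H : Subgroup G}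

/-- `G` is the direct product of an invariant subgroup `c.range ≅ C₄`, on whose cosets `Γ` acts
as a `p`-group, and a subgroup `H` of exponent `p` and order `p ^ 2` which is not invariant. -/
structure Setting (p : ℕ) (Γ : Subgroup (Equiv.Perm G)) (c : Multiplicative (ZMod 4) →* G)
    (H : Subgroup G) : Prop where
  prime : p.Prime
  odd : Odd p
  right : rightTranslations G ≤ Γ
  isInv : IsInv Γ (c.range : Set G)
  isPGroup : IsPGroup p (quotPerm Γ right c.range isInv).range
  injective : Function.Injective c
  eq_one : ∀ e, c e ∈ H → e = 1
  exists_eq : ∀ x, ∃ e, ∃ h ∈ H, x = c e * h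
  pow_eq_one : ∀ h ∈ H, h ^ p = 1
  card_eq : Nat.card H = p ^ 2
  not_isInv : ¬ IsInv Γ (H : Set G)

namespace Setting

/-- The subgroup of all `x` such that the coset `Cx` is invariant. -/
abbrev stab (S : Setting p Γ c H) : Subgroup G := cosetStab Γ S.right c.range S.isInv

/-- The part of `stab` in `H`. -/
abbrev core (S : Setting p Γ c H) : Subgroup G := S.stab ⊓ H

variable (S : Setting p Γ c H)
include S

omit [Finite G] in
lemma injective_mul {V : Subgroup G} (hV : V ≤ H) (g : G) :
    Function.Injective fun q : Multiplicative (ZMod 4) × V => c q.1 * q.2 * g := by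
  rintro ⟨e, v, hv⟩ ⟨f, w, hw⟩ h
  have h1 : c e * v = c f * w := mul_right_cancel h
  have h2 : c (f⁻¹ * e) = w * v⁻¹ := by
    rw [map_mul, map_inv, eq_mul_inv_iff_mul_eq, mul_assoc, h1, inv_mul_cancel_left]
  have h3 := S.eq_one _ (h2 ▸ H.mul_mem (hV hw) (H.inv_mem (hV hv)))
  obtain rfl : f = e := inv_mul_eq_one.1 h3
  obtain rfl : v = w := mul_left_cancel h1
  rfl

omit [Finite G] in
lemma ncard_range {V : Subgroup G} (hV : V ≤ H) (g : G) :
    (Set.range fun q : Multiplicative (ZMod 4) × V => c q.1 * q.2 * g).ncard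
      = 4 * Nat.card V := by
  rw [← Set.image_univ, Set.ncard_image_of_injective _ (S.injective_mul hV g), Set.ncard_univ,
    Nat.card_prod]
  congr 1
  exact Nat.card_zmod 4

omit [Finite G] in
lemma card_univ : Nat.card G = 4 * p ^ 2 := by
  rw [← S.card_eq, ← S.ncard_range le_rfl 1, ← Set.ncard_univ]
  congr 1
  refine (Set.eq_univ_of_forall fun x => ?_).symm
  obtain ⟨e, h, hh, rfl⟩ := S.exists_eq x
  exact ⟨(e, ⟨h, hh⟩), mul_one _⟩

omit [Finite G] in
lemma card_range : Nat.card c.range = 4 := by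
  rw [← Nat.card_congr (MonoidHom.ofInjective S.injective).toEquiv]
  exact Nat.card_zmod 4

omit [Finite G] in
lemma card_quot : Nat.card (G ⧸ c.range) = p ^ 2 := by
  have h := Subgroup.card_eq_card_quotient_mul_card_subgroup c.range
  rw [S.card_univ, S.card_range] at h
  omega

omit [Finite G] in
lemma range_le_stab : c.range ≤ S.stab := le_cosetStab

omit [Finite G] in
lemma exists_eq_of_mem_stab {x : G} (hx : x ∈ S.stab) : ∃ e, ∃ v ∈ S.core, x = c e * v := by
  obtain ⟨e, h, hh, rfl⟩ := S.exists_eq x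
  refine ⟨e, h, ⟨?_, hh⟩, rfl⟩
  have := S.stab.mul_mem (S.stab.inv_mem (S.range_le_stab ⟨e, rfl⟩)) hx
  rwa [inv_mul_cancel_left] at this

lemma card_core (hU : S.stab ≠ ⊤) : Nat.card S.core = p := by
  have := Fact.mk S.prime
  have h1 : Nat.card S.core ∣ p ^ 2 := S.card_eq ▸ Subgroup.card_dvd_of_le inf_le_right
  obtain ⟨i, hi, h⟩ := (Nat.dvd_prime_pow S.prime).1 h1
  interval_cases i
  · obtain ⟨x, hx, hxC⟩ := exists_mem_cosetStab S.isPGroup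
      (by rw [S.card_quot]; exact dvd_pow_self _ two_ne_zero)
    obtain ⟨e, v, hv, rfl⟩ := S.exists_eq_of_mem_stab hx
    rw [pow_zero, Subgroup.card_eq_one] at h
    rw [h, Subgroup.mem_bot] at hv
    exact absurd ⟨e, by simp [hv]⟩ hxC
  · rw [h, pow_one]
  · refine absurd (top_unique fun x _ => ?_) hU
    have h2 : S.core = H := Subgroup.eq_of_le_of_card_ge inf_le_right (by rw [h, S.card_eq])
    obtain ⟨e, v, hv, rfl⟩ := S.exists_eq x
    rw [← h2] at hv
    exact S.stab.mul_mem (S.range_le_stab ⟨e, rfl⟩) hv.1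

omit [Finite G] in
lemma isInv_stab : IsInv Γ (S.stab : Set G) := isInv_of_le_cosetStab S.range_le_stab le_rfl

omit [Finite G] in
lemma isInv_coset {v : G} (hv : v ∈ S.stab) : IsInv Γ {x | x * v⁻¹ ∈ c.range} := by
  refine isInv_of_cell_subset fun x hx y hy => ?_
  have hxU : x ∈ S.stab := by
    simpa using S.stab.mul_mem (S.range_le_stab hx) hv
  simpa using c.range.mul_mem (hxU hy) hx

/-- If the union of cosets `C (cell g)` meets its translate by an element of `stab`, then it is
invariant under this translation. -/
lemma mul_mem_of_mul_mem {g v t : G} (hv : v ∈ S.stab) (ht : t ∈ (c.range : Set G) * cell Γ g)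
    (hvt : v * t ∈ (c.range : Set G) * cell Γ g) {u : G} (hu : u ∈ Subgroup.zpowers v)
    {x : G} (hx : x ∈ (c.range : Set G) * cell Γ g) : u * x ∈ (c.range : Set G) * cell Γ g := by
  set T := (c.range : Set G) * cell Γ g with hT
  have hCT : ∀ a ∈ c.range, ∀ b ∈ T, a * b ∈ T := by
    rintro a ha _ ⟨b, hb, y, hy, rfl⟩
    exact ⟨a * b, c.range.mul_mem ha hb, y, hy, mul_assoc _ _ _⟩
  have hinv : IsInv Γ ({x | x * v⁻¹ ∈ c.range} * T) :=
    (S.isInv_coset hv).mul S.right (S.isInv.mul S.right (isInv_cell g))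
  have hsub : ∀ y ∈ T, v⁻¹ * y ∈ T := by
    obtain ⟨a, ha, y, hy, hay⟩ := hvt
    have hy' : y ∈ {x | x * v⁻¹ ∈ c.range} * T := by
      refine ⟨a⁻¹ * v, ?_, t, ht, ?_⟩
      · rw [Set.mem_ofPred_eq, mul_inv_cancel_right]
        exact c.range.inv_mem ha
      · simp only at hay ⊢
        rw [mul_assoc, ← hay, inv_mul_cancel_left]
    have hcell := hinv.cell_subset (hinv.cell_subset hy' (mem_cell_comm hy))
    rintro _ ⟨b, hb, z, hz, rfl⟩
    obtain ⟨w, hw, t', ht', rfl⟩ := hcell hz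
    have := hCT _ (c.range.mul_mem hb hw) _ ht'
    convert this using 1
    rw [mul_comm w, mul_assoc b, mul_assoc v⁻¹]
    exact mul_left_comm _ _ _
  have hpow : ∀ (n : ℕ), ∀ y ∈ T, v⁻¹ ^ n * y ∈ T := by
    intro n
    induction n with
    | zero => simp
    | succ n ih => intro y hy; rw [pow_succ, mul_assoc]; exact ih _ (hsub y hy)
  rw [← Subgroup.zpowers_inv] at hu
  obtain ⟨n, rfl⟩ := (mem_powers_iff_mem_zpowers (x := v⁻¹)).2 hu
  exact hpow n x hx

/-- The structure of the cells outside `stab`. -/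
lemma mul_cell_eq (hU : S.stab ≠ ⊤) {g : G} (hg : g ∉ S.stab) :
    (c.range : Set G) * cell Γ g =
      Set.range fun q : Multiplicative (ZMod 4) × S.core => c q.1 * q.2 * g := by
  have := Fact.mk S.prime
  have hV := S.card_core hU
  set T := (c.range : Set G) * cell Γ g with hT
  have hTU : ∀ t ∈ T, t ∉ S.stab := by
    rintro _ ⟨a, ha, y, hy, rfl⟩ h
    refine hg (S.isInv_stab.cell_subset ?_ (mem_cell_comm hy))
    simpa using S.stab.mul_mem (S.stab.inv_mem (S.range_le_stab ha)) h
  have hCg : ∀ e, c e * g ∈ T := fun e => ⟨_, ⟨e, rfl⟩, g, mem_cell_self g, rfl⟩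
  obtain ⟨a, ha⟩ := exists_ncard_mul_cell S.isPGroup g
  rw [S.card_range] at ha
  by_cases hex : ∃ v ∈ S.core, v ≠ 1 ∧ ∃ t ∈ T, v * t ∈ T
  · obtain ⟨v, hv, hv1, t, ht, hvt⟩ := hex
    have hsub : (Set.range fun q : Multiplicative (ZMod 4) × S.core => c q.1 * q.2 * g) ⊆ T := by
      rintro _ ⟨⟨e, u, hu⟩, rfl⟩
      have hz : (⟨u, hu⟩ : S.core) ∈ Subgroup.zpowers (⟨v, hv⟩ : S.core) :=
        mem_zpowers_of_prime_card hV (by simpa [Subtype.ext_iff] using hv1)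
      obtain ⟨n, hn⟩ := hz
      have hn' : v ^ n = u := congrArg Subtype.val hn
      have := S.mul_mem_of_mul_mem hv.1 ht hvt ⟨n, hn'⟩ (hCg e)
      simp only
      rwa [mul_comm (c e), mul_assoc]
    refine (Set.eq_of_subset_of_ncard_le hsub ?_).symm
    rw [S.ncard_range inf_le_right, hV, ha]
    have hlt : T.ncard < Nat.card G := by
      rw [← Set.ncard_univ]
      refine Set.ncard_lt_ncard ⟨Set.subset_univ _, fun h => ?_⟩
      exact hTU 1 (h (Set.mem_univ _)) (one_mem _)
    rw [ha, S.card_univ] at hlt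
    have : a < 2 := (Nat.pow_lt_pow_iff_right S.prime.one_lt).1 (by omega)
    exact Nat.mul_le_mul_left _ ((Nat.pow_le_pow_right S.prime.pos (by omega)).trans_eq (pow_one p))
  · exfalso
    push Not at hex
    have hinj : Function.Injective fun q : S.core × T => (q.1 : G) * q.2 := by
      rintro ⟨⟨v, hv⟩, t, ht⟩ ⟨⟨w, hw⟩, s, hs⟩ h
      simp only at h
      have h1 : w⁻¹ * v = 1 := by
        by_contra hne
        refine hex _ (S.core.mul_mem (S.core.inv_mem hw) hv) hne t ht ?_
        rw [mul_assoc, h, inv_mul_cancel_left]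
        exact hs
      obtain rfl := inv_mul_eq_one.1 h1
      obtain rfl := mul_left_cancel h
      rfl
    have hlt : (Set.range fun q : S.core × T => (q.1 : G) * q.2).ncard < Nat.card G := by
      rw [← Set.ncard_univ]
      refine Set.ncard_lt_ncard ⟨Set.subset_univ _, fun h => ?_⟩
      obtain ⟨⟨⟨v, hv⟩, t, ht⟩, h1⟩ := h (Set.mem_univ 1)
      refine hTU t ht ?_
      rw [← inv_eq_of_mul_eq_one_right (show v * t = 1 from h1)]
      exact inv_mem hv.1
    rw [← Set.image_univ, Set.ncard_image_of_injective _ hinj, Set.ncard_univ, Nat.card_prod,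
      Nat.card_coe_set_eq, ha, hV, S.card_univ] at hlt
    have h0 : a = 0 := by
      by_contra h0
      have : p ≤ p ^ a := Nat.le_self_pow h0 p
      nlinarith [S.prime.pos]
    refine hg ?_
    have hsub : (Set.range fun q : Multiplicative (ZMod 4) × (⊥ : Subgroup G) =>
        c q.1 * q.2 * g) ⊆ T := by
      rintro _ ⟨⟨e, u, hu⟩, rfl⟩
      rw [Subgroup.mem_bot] at hu
      simpa [hu] using hCg e
    have heq := Set.eq_of_subset_of_ncard_le hsub (by
      rw [S.ncard_range bot_le, ha, h0]; simp)
    intro y hy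
    have hyT : y ∈ T := ⟨1, c.range.one_mem, y, hy, one_mul y⟩
    rw [← heq] at hyT
    obtain ⟨⟨e, u, hu⟩, rfl⟩ := hyT
    rw [Subgroup.mem_bot] at hu
    exact ⟨e, by simp [hu]⟩

end Setting

end Structure

section Core

variable {G : Type*} [CommGroup G] {p : ℕ} {Γ : Subgroup (Equiv.Perm G)}
  {c : Multiplicative (ZMod 4) →* G} {H D : Subgroup G}

/-- The partition into cells is a wreath product over a section `U/L` on which it is discrete. -/
def HasWreath (Γ : Subgroup (Equiv.Perm G)) : Prop :=
  ∃ U L : Subgroup G, L ≤ U ∧ IsInv Γ (U : Set G) ∧ IsInv Γ (L : Set G) ∧ L ≠ ⊥ ∧ U ≠ ⊤ ∧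
    (∀ g ∉ U, ∀ l ∈ L, ∀ x ∈ cell Γ g, l * x ∈ cell Γ g) ∧
    ∀ x ∈ U, ∀ y ∈ cell Γ x, x⁻¹ * y ∈ L

lemma isInv_bot : IsInv Γ ((⊥ : Subgroup G) : Set G) := by simpa using isInv_one

lemma exists_isLeast4 (Γ : Subgroup (Equiv.Perm G)) (c : Multiplicative (ZMod 4) →* G) :
    ∃ D, IsLeast4 Γ c D := by
  by_cases h : IsInv Γ (Subgroup.zpowers (c invol) : Set G)
  exacts [⟨_, Or.inl ⟨rfl, h⟩⟩, ⟨_, Or.inr ⟨rfl, h⟩⟩]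

lemma map_mul_pow_eight (c : Multiplicative (ZMod 4) →* G) (e : Multiplicative (ZMod 4)) (h : G) :
    (c e * h) ^ 8 = h ^ 8 := by
  rw [mul_pow, ← map_pow, (by decide : ∀ e : Multiplicative (ZMod 4), e ^ 8 = 1) e, map_one,
    one_mul]

namespace Setting

variable (S : Setting p Γ c H)
include S

lemma map_eq_one {e : Multiplicative (ZMod 4)} (h : c e = 1) : e = 1 :=
  S.injective (h.trans (map_one c).symm)

lemma ne_bot (hD : IsLeast4 Γ c D) : D ≠ ⊥ := by
  rintro rfl
  exact absurd (S.map_eq_one (Subgroup.mem_bot.1 hD.invol_mem)) (by decide)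

lemma mem_of_pow_eight_mem {A : Subgroup G} {h : G} (hh : h ∈ H) (h8 : h ^ 8 ∈ A) : h ∈ A := by
  have h1 : Nat.Coprime 8 (orderOf h) := by
    refine Nat.Coprime.coprime_dvd_right (orderOf_dvd_of_pow_eq_one (S.pow_eq_one h hh)) ?_
    exact Nat.Coprime.pow_left 3 (Nat.coprime_two_left.2 S.odd)
  obtain ⟨m, hm⟩ := exists_pow_eq_self_of_coprime h1
  rw [← hm]
  exact A.pow_mem h8 m

lemma not_le_cosetStab {N : Subgroup G} {hN : IsInv Γ (N : Set G)} (hNH : N ≤ H) :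
    ¬ H ≤ cosetStab Γ S.right N hN :=
  fun h => S.not_isInv (isInv_of_le_cosetStab hNH h)

lemma isInv_core_of_le (h : S.core ≤ cosetStab Γ S.right ⊥ isInv_bot) :
    IsInv Γ (S.core : Set G) :=
  isInv_of_le_cosetStab bot_le h

lemma mul_mem_cell_or (hD : IsLeast4 Γ c D) {g : G} (hg : g ∈ S.stab) :
    (∀ d ∈ D, ∀ x ∈ cell Γ g, d * x ∈ cell Γ g) ∨
      g ^ 8 ∈ cosetStab Γ S.right ⊥ isInv_bot := by
  have := hD.mul_mem_or_pow_mem (N := ⊥) (hΓ := S.right) (g := g) isInv_bot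
    (fun e he => S.map_eq_one (Subgroup.mem_bot.1 he)) S.isInv ?_
  · simpa using this
  · intro y hy
    obtain ⟨e, he⟩ := hg hy
    exact ⟨e, Finset.mem_univ _, by simp [he]⟩

lemma mul_mem_core_mul_cell (hU : S.stab ≠ ⊤) [Finite G] (hD : IsLeast4 Γ c D)
    (hV : IsInv Γ (S.core : Set G)) {g : G} (hg : g ∉ S.stab) :
    ∀ d ∈ D, ∀ x ∈ (S.core : Set G) * cell Γ g, d * x ∈ (S.core : Set G) * cell Γ g := by
  have := Fact.mk S.prime
  refine (hD.mul_mem_or_pow_mem (N := S.core) (hΓ := S.right) (g := g) hV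
    (fun e he => S.eq_one e he.2) S.isInv ?_).resolve_right fun h8 => ?_
  · intro y hy
    have hy' : y ∈ (c.range : Set G) * cell Γ g := ⟨1, one_mem _, y, hy, one_mul y⟩
    rw [S.mul_cell_eq hU hg] at hy'
    obtain ⟨⟨e, v, hv⟩, rfl⟩ := hy'
    refine ⟨e, Finset.mem_univ _, ?_⟩
    simpa [mul_comm (c e), mul_assoc] using hv
  · refine S.not_le_cosetStab (hN := hV) inf_le_right ?_
    obtain ⟨e, h, hh, rfl⟩ := S.exists_eq g
    rw [map_mul_pow_eight] at h8
    have hh' := S.mem_of_pow_eight_mem hh h8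
    have hcard : Nat.card ↥(cosetStab Γ S.right S.core hV ⊓ H : Subgroup G) ∣ p ^ 2 :=
      S.card_eq ▸ Subgroup.card_dvd_of_le inf_le_right
    obtain ⟨i, hi, hcard⟩ := (Nat.dvd_prime_pow S.prime).1 hcard
    have hle : S.core ≤ cosetStab Γ S.right S.core hV ⊓ H := le_inf le_cosetStab inf_le_right
    have hpc := S.card_core hU
    have hi1 : ¬ i ≤ 1 := fun hi1 => by
      have heq := Subgroup.eq_of_le_of_card_ge hle (by
        rw [hcard, hpc]; exact (Nat.pow_le_pow_right S.prime.pos hi1).trans_eq (pow_one p))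
      have hmem : h ∈ S.core := heq ▸ ⟨hh', hh⟩
      exact hg (mul_mem (S.range_le_stab ⟨e, rfl⟩) hmem.1)
    obtain rfl : i = 2 := by omega
    have heq := Subgroup.eq_of_le_of_card_ge
      (inf_le_right : cosetStab Γ S.right S.core hV ⊓ H ≤ H) (by rw [hcard, S.card_eq])
    exact heq.ge.trans inf_le_left

lemma inv_mul_mem_of_mem_cosetStab (hD : IsLeast4 Γ c D) {e : Multiplicative (ZMod 4)} {s y : G}
    (hs : s ∈ cosetStab Γ S.right ⊥ isInv_bot) (hy : y ∈ cell Γ (c e * s)) :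
    (c e * s)⁻¹ * y ∈ D := by
  have h1 := mul_inv_mem_cell_of_mem_cosetStab_bot hs hy
  rw [mul_inv_cancel_right] at h1
  have := hD.mul_inv_mem S.isInv ⟨e, rfl⟩ h1
  convert this using 1
  rw [mul_inv, mul_assoc, mul_comm s⁻¹]

lemma hasWreath_of_stab_eq_top (hU : S.stab = ⊤) : HasWreath Γ := by
  obtain ⟨D, hD⟩ := exists_isLeast4 Γ c
  have hmem : ∀ g, g ∈ S.stab := fun g => hU ▸ Subgroup.mem_top g
  set A := cosetStab Γ S.right ⊥ isInv_bot with hA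
  have hrange : c.range ≤ A.comap (powMonoidHom 8) := by
    rintro _ ⟨e, rfl⟩
    have := map_mul_pow_eight c e 1
    rw [mul_one, one_pow] at this
    change c e ^ 8 ∈ A
    rw [this]
    exact one_mem A
  refine ⟨A.comap (powMonoidHom 8), D, hD.le.trans hrange, ?_, hD.isInv S.isInv, S.ne_bot hD, ?_,
    ?_, ?_⟩
  · refine isInv_of_cell_subset fun x hx y hy => ?_
    have := Subgroup.mul_mem _ (hrange (hmem x hy)) hx
    rwa [inv_mul_cancel_right] at this
  · intro h
    refine S.not_le_cosetStab (N := ⊥) (hN := isInv_bot) bot_le fun x hx => ?_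
    have hx' : x ∈ A.comap (powMonoidHom 8) := h ▸ Subgroup.mem_top x
    exact S.mem_of_pow_eight_mem hx hx'
  · exact fun g hg => (S.mul_mem_cell_or hD (hmem g)).resolve_right hg
  · intro x hx y hy
    obtain ⟨e, h, hh, rfl⟩ := S.exists_eq x
    have h8 : (c e * h) ^ 8 ∈ A := hx
    rw [map_mul_pow_eight] at h8
    exact S.inv_mul_mem_of_mem_cosetStab hD (S.mem_of_pow_eight_mem hh h8) hy

end Setting

end Core

section Slices

variable {G : Type*} [CommGroup G] {p : ℕ} {Γ : Subgroup (Equiv.Perm G)}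
  {c : Multiplicative (ZMod 4) →* G} {H D : Subgroup G}

open Classical in
/-- The set of all `e` such that `(c e) h` lies in `Y`. -/
def slice (c : Multiplicative (ZMod 4) →* G) (Y : Set G) (h : G) :
    Finset (Multiplicative (ZMod 4)) :=
  Finset.univ.filter fun e => c e * h ∈ Y

lemma mem_slice {Y : Set G} {h : G} {e : Multiplicative (ZMod 4)} :
    e ∈ slice c Y h ↔ c e * h ∈ Y := by
  simp [slice]

lemma slice_card_pos (g : G) : 0 < (slice c (cell Γ g) g).card :=
  Finset.card_pos.2 ⟨1, mem_slice.2 (by simpa using mem_cell_self g)⟩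

lemma mem_singleton_mul_slice {Y : Set G} {h : G} {e f : Multiplicative (ZMod 4)} :
    f ∈ {e} * slice c Y h ↔ c (e⁻¹ * f) * h ∈ Y := by
  rw [← mem_slice]
  constructor
  · rintro h
    obtain ⟨a, ha, b, hb, rfl⟩ := Finset.mem_mul.1 h
    obtain rfl := Finset.mem_singleton.1 ha
    rwa [inv_mul_cancel_left]
  · intro h
    exact Finset.mem_mul.2 ⟨e, Finset.mem_singleton_self e, _, h, mul_inv_cancel_left _ _⟩

namespace Setting

variable (S : Setting p Γ c H)
include S

lemma ncard_eq_sum_slice {V : Subgroup G} [Fintype V] (hV : V ≤ H) {Y : Set G} {g : G}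
    (hY : Y ⊆ Set.range fun q : Multiplicative (ZMod 4) × V => c q.1 * q.2 * g) :
    Y.ncard = ∑ w : V, (slice c Y (w * g)).card := by
  classical
  rw [← Set.image_preimage_eq_of_subset hY,
    Set.ncard_image_of_injective _ (S.injective_mul hV g), Set.image_preimage_eq_of_subset hY,
    show ((fun q : Multiplicative (ZMod 4) × V => c q.1 * q.2 * g) ⁻¹' Y) =
      ↑(Finset.univ.filter fun q : Multiplicative (ZMod 4) × V => c q.1 * q.2 * g ∈ Y) by
        ext; simp,
    Set.ncard_coe_finset, Finset.card_filter, Fintype.sum_prod_type_right]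
  refine Finset.sum_congr rfl fun w _ => ?_
  rw [slice, Finset.card_filter]
  simp only [mul_assoc]

lemma card_slice [Finite G] {g : G} (h : G) (hg : h ∈ (c.range : Set G) * cell Γ g) :
    (slice c (cell Γ g) h).card = (slice c (cell Γ g) g).card := by
  have key : ∀ h, (slice c (cell Γ g) h).card = {x ∈ cell Γ g | h * x⁻¹ ∈ c.range}.ncard := by
    intro h
    rw [← Set.ncard_coe_finset, ← Set.ncard_image_of_injective (slice c (cell Γ g) h : Set _)
      (f := fun e => c e * h) fun a b hab => S.injective (mul_right_cancel hab)]
    congr 1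
    ext x
    constructor
    · rintro ⟨e, he, rfl⟩
      exact ⟨mem_slice.1 he, e⁻¹, by simp [mul_comm]⟩
    · rintro ⟨hx, e, he⟩
      have hxe : c e⁻¹ * h = x := by rw [map_inv, he]; simp
      exact ⟨e⁻¹, mem_slice.2 (hxe ▸ hx), hxe⟩
  obtain ⟨_, ⟨e, rfl⟩, y, hy, rfl⟩ := hg
  rw [key, key]
  refine Eq.trans ?_ ((isInv_cell g).ncard_eq S.right S.isInv hy)
  congr 1
  ext x
  refine and_congr_right fun _ => ?_
  simp only
  rw [mul_assoc]
  exact c.range.mul_mem_cancel_left ⟨e, rfl⟩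

end Setting

end Slices

section Parity

lemma sum_card_inter_singleton_mul (A B : Finset (Multiplicative (ZMod 4))) :
    ∑ e, (A ∩ ({e} * B)).card = A.card * B.card := by
  revert A B
  decide

lemma exists_card_inter_mod_four : ∃ F : Finset (Multiplicative (ZMod 4)) → ZMod 4,
    ∀ A B : Finset (Multiplicative (ZMod 4)), A.card = 2 → B.card = 2 →
      ((3 * (A ∩ ({1} * B)).card + 2 * (A ∩ ({Multiplicative.ofAdd 1} * B)).card
        + (A ∩ ({invol} * B)).card : ℕ) : ZMod 4) = 2 * F A + 2 * F B :=
  ⟨fun A => if {invol} * A = A then 1 else 0, by decide⟩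

lemma card_inter_add_card_inter (A B : Finset (Multiplicative (ZMod 4))) (hA : A.card = 2)
    (hB : B.card = 2) (h : B ∩ ({invol} * B) = ∅) :
    (A ∩ ({1} * B)).card + (A ∩ ({invol} * B)).card = 2 := by
  revert A B
  decide

variable {V : Type*} [CommGroup V] [Fintype V] {E : V → Finset (Multiplicative (ZMod 4))} {k : ℕ}
  {v : V} {n : Multiplicative (ZMod 4) → ℕ}

lemma two_mul_add_eq (hk : ∀ w, (E w).card = k)
    (hn : ∀ e, n e = ∑ w, (E w ∩ ({e} * E (w * v⁻¹))).card) (hinv : ∀ e, n (invol * e) = n e) :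
    2 * (n 1 + n (Multiplicative.ofAdd 1)) = Fintype.card V * (k * k) := by
  have h1 : ∑ e, n e = Fintype.card V * (k * k) := by
    simp_rw [hn]
    rw [Finset.sum_comm]
    simp_rw [sum_card_inter_singleton_mul, hk]
    simp
  have h2 : ∑ e, n e = n 1 + n (Multiplicative.ofAdd 1) + n invol +
      n (invol * Multiplicative.ofAdd 1) := Fin.sum_univ_four n
  have h3 := hinv 1
  rw [mul_one] at h3
  rw [h3, hinv] at h2
  omega

lemma even_card_of_eq (hk : ∀ w, (E w).card = 2)
    (hn : ∀ e, n e = ∑ w, (E w ∩ ({e} * E (w * v⁻¹))).card) (hinv : ∀ e, n (invol * e) = n e)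
    (heq : n 1 = n (Multiplicative.ofAdd 1)) : Even (Fintype.card V) := by
  have h1 := two_mul_add_eq hk hn hinv
  have h3 := hinv 1
  rw [mul_one] at h3
  obtain ⟨F, hF⟩ := exists_card_inter_mod_four
  have h4 : ((3 * n 1 + 2 * n (Multiplicative.ofAdd 1) + n invol : ℕ) : ZMod 4) = 0 := by
    simp_rw [hn, Finset.mul_sum, ← Finset.sum_add_distrib]
    rw [Nat.cast_sum, Finset.sum_congr rfl fun w _ => hF _ _ (hk w) (hk (w * v⁻¹)),
      Finset.sum_add_distrib, show ∑ w, 2 * F (E (w * v⁻¹)) = ∑ w, 2 * F (E w) from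
        Equiv.sum_comp (Equiv.mulRight v⁻¹) fun w => 2 * F (E w),
      ← Finset.mul_sum, ← add_mul]
    rw [show (2 + 2 : ZMod 4) = 0 from rfl, zero_mul]
  rw [ZMod.natCast_eq_zero_iff] at h4
  rw [Nat.even_iff]
  omega

end Parity

section CoreCases

variable {G : Type*} [CommGroup G] [Finite G] {p : ℕ} {Γ : Subgroup (Equiv.Perm G)}
  {c : Multiplicative (ZMod 4) →* G} {H D : Subgroup G}

namespace Setting

variable (S : Setting p Γ c H)
include S

lemma cell_subset_range (hU : S.stab ≠ ⊤) {g : G} (hg : g ∉ S.stab) :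
    cell Γ g ⊆ Set.range fun q : Multiplicative (ZMod 4) × S.core => c q.1 * q.2 * g := by
  rw [← S.mul_cell_eq hU hg]
  exact fun y hy => ⟨1, one_mem _, y, hy, one_mul y⟩

lemma card_slice_eq (hU : S.stab ≠ ⊤) {g : G} (hg : g ∉ S.stab) (w : S.core) :
    (slice c (cell Γ g) (w * g)).card = (slice c (cell Γ g) g).card := by
  refine S.card_slice _ ?_
  rw [S.mul_cell_eq hU hg]
  exact ⟨(1, w), by simp⟩

lemma exists_pow_eq (hU : S.stab ≠ ⊤) {v w : G} (hv : v ∈ S.core) (hv1 : v ≠ 1)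
    (hw : w ∈ S.core) : ∃ n : ℕ, v ^ n = w := by
  have := Fact.mk S.prime
  have h : (⟨w, hw⟩ : S.core) ∈ Submonoid.powers (⟨v, hv⟩ : S.core) :=
    mem_powers_of_prime_card (S.card_core hU) (by simpa [Subtype.ext_iff] using hv1)
  obtain ⟨n, hn⟩ := h
  exact ⟨n, congrArg Subtype.val hn⟩

lemma core_mul_mem_cell (hU : S.stab ≠ ⊤) (hD : IsLeast4 Γ c D)
    (hV : S.core ≤ cosetStab Γ S.right ⊥ isInv_bot) {g : G} (hg : g ∉ S.stab) :
    ∀ v ∈ S.core, ∀ x ∈ cell Γ g, v * x ∈ cell Γ g := by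
  classical
  by_cases hex : ∃ v ∈ S.core, v ≠ 1 ∧ ∃ t ∈ cell Γ g, v * t ∈ cell Γ g
  · obtain ⟨v, hv, hv1, t, ht, hvt⟩ := hex
    have hstep : ∀ x ∈ cell Γ g, v * x ∈ cell Γ g := by
      intro x hx
      rw [← cell_eq_of_mem ht] at hx
      have := mul_inv_mem_cell_of_mem_cosetStab_bot (inv_mem (hV hv)) hx
      rwa [inv_inv, mul_comm x, mul_comm t, cell_eq_of_mem hvt] at this
    intro w hw
    obtain ⟨n, rfl⟩ := S.exists_pow_eq hU hv hv1 hw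
    clear hw
    induction n with
    | zero => simp
    | succ n ih => intro x hx; rw [pow_succ, mul_assoc]; exact ih _ (hstep x hx)
  · exfalso
    push Not at hex
    let _ : Fintype S.core := Fintype.ofFinite _
    set E : Finset (Multiplicative (ZMod 4)) :=
      Finset.univ.biUnion fun w : S.core => slice c (cell Γ g) (w * g) with hE
    have hcard : E.card = p * (slice c (cell Γ g) g).card := by
      rw [hE, Finset.card_biUnion]
      · simp_rw [S.card_slice_eq hU hg]
        rw [Finset.sum_const, Finset.card_univ, ← Nat.card_eq_fintype_card, S.card_core hU,
          smul_eq_mul]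
      · intro w _ w' _ hne
        rw [Function.onFun, Finset.disjoint_left]
        intro e he he'
        rw [mem_slice] at he he'
        refine hex _ (w' * w⁻¹).2 ?_ _ he ?_
        · rw [Ne, OneMemClass.coe_eq_one, mul_inv_eq_one]
          exact hne.symm
        · convert he' using 1
          simp only [Subgroup.coe_mul, Subgroup.coe_inv]
          rw [mul_left_comm, ← mul_assoc (_ * _) _ g, inv_mul_cancel_right]
    have hinv : {invol} * E ⊆ E := by
      intro f hf
      obtain ⟨a, ha, e, he, rfl⟩ := Finset.mem_mul.1 hf
      obtain rfl := Finset.mem_singleton.1 ha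
      obtain ⟨w, -, he⟩ := Finset.mem_biUnion.1 he
      rw [mem_slice] at he
      obtain ⟨v, hv, x, hx, hvx⟩ := S.mul_mem_core_mul_cell hU hD (S.isInv_core_of_le hV) hg _
        hD.invol_mem _ ⟨1, one_mem _, _, he, one_mul _⟩
      refine Finset.mem_biUnion.2 ⟨⟨v, hv⟩⁻¹ * w, Finset.mem_univ _, mem_slice.2 ?_⟩
      convert hx using 1
      simp only at hvx
      rw [← inv_mul_eq_iff_eq_mul.2 hvx.symm]
      simp only [map_mul, Subgroup.coe_mul, Subgroup.coe_inv]
      simp only [mul_assoc, mul_left_comm]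
    have h4 : E.card ≤ 4 := Finset.card_le_univ E
    have hpos := slice_card_pos (c := c) (Γ := Γ) g
    have h3 : E.card = 3 := by
      have h2 := S.prime.two_le
      have hodd := S.odd
      rw [hcard] at h4 ⊢
      have hp3 : 3 ≤ p := by
        obtain ⟨m, rfl⟩ := hodd
        omega
      have hk1 : (slice c (cell Γ g) g).card = 1 := by nlinarith
      rw [hk1, mul_one] at h4 ⊢
      obtain ⟨m, rfl⟩ := hodd
      omega
    clear_value E
    clear hE hcard h4
    revert E
    decide

lemma hasWreath_of_core_le (hU : S.stab ≠ ⊤)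
    (hV : S.core ≤ cosetStab Γ S.right ⊥ isInv_bot) : HasWreath Γ := by
  obtain ⟨D, hD⟩ := exists_isLeast4 Γ c
  refine ⟨S.stab, D ⊔ S.core, sup_le (hD.le.trans S.range_le_stab) inf_le_left, S.isInv_stab, ?_,
    fun h => S.ne_bot hD (sup_eq_bot_iff.1 h).1, hU, ?_, ?_⟩
  · rw [Subgroup.mul_normal]
    exact (hD.isInv S.isInv).mul S.right (S.isInv_core_of_le hV)
  · intro g hg l hl x hx
    obtain ⟨d, hd, v, hv, rfl⟩ := Subgroup.mem_sup.1 hl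
    have h1 := S.core_mul_mem_cell hU hD hV hg
    obtain ⟨w, hw, y, hy, hwy⟩ := S.mul_mem_core_mul_cell hU hD (S.isInv_core_of_le hV) hg d hd
      (v * x) ⟨v, hv, x, hx, rfl⟩
    rw [mul_assoc, ← hwy]
    exact h1 w hw y hy
  · intro x hx y hy
    obtain ⟨e, v, hv, rfl⟩ := S.exists_eq_of_mem_stab hx
    exact (le_sup_left : D ≤ D ⊔ S.core) (S.inv_mul_mem_of_mem_cosetStab hD (hV hv) hy)

lemma mul_mem_cell_of_mul_mem_cell (hU : S.stab ≠ ⊤) (hD : IsLeast4 Γ c D)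
    (h : ∀ v ∈ S.core, v ≠ 1 → ∀ e, ∀ d ∈ D, d * (c e * v) ∈ cell Γ (c e * v)) {g : G}
    (hg : g ∉ S.stab) : ∀ d ∈ D, ∀ x ∈ cell Γ g, d * x ∈ cell Γ g := by
  classical
  let _ : Fintype S.core := Fintype.ofFinite _
  have hV : Fintype.card S.core = p := by rw [← Nat.card_eq_fintype_card, S.card_core hU]
  have hVodd : ¬ Even (Fintype.card S.core) := by rw [hV, Nat.not_even_iff_odd]; exact S.odd
  have : Nontrivial S.core :=
    Fintype.one_lt_card_iff_nontrivial.1 (by rw [hV]; exact S.prime.one_lt)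
  obtain ⟨⟨v, hv⟩, hv1⟩ := exists_ne (1 : S.core)
  have hv1' : v ≠ 1 := by simpa [Subtype.ext_iff] using hv1
  set E : S.core → Finset (Multiplicative (ZMod 4)) := fun w => slice c (cell Γ g) (w * g) with hE
  set n : Multiplicative (ZMod 4) → ℕ :=
    fun e => {x ∈ cell Γ g | c e * v * x⁻¹ ∈ (cell Γ g)⁻¹}.ncard with hn_def
  have hk : ∀ w, (E w).card = (slice c (cell Γ g) g).card := fun w => S.card_slice_eq hU hg w
  have hn : ∀ e, n e = ∑ w, (E w ∩ ({e} * E (w * (⟨v, hv⟩ : S.core)⁻¹))).card := by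
    intro e
    rw [hn_def]
    simp only
    rw [S.ncard_eq_sum_slice (V := S.core) (g := g) inf_le_right fun x hx =>
      S.cell_subset_range hU hg hx.1]
    refine Finset.sum_congr rfl fun w _ => congrArg _ ?_
    ext f
    rw [Finset.mem_inter, mem_singleton_mul_slice, mem_slice, mem_slice]
    refine and_congr_right fun _ => ?_
    rw [Set.mem_inv]
    refine iff_of_eq (congrArg (· ∈ cell Γ g) ?_)
    simp only [map_mul, map_inv, Subgroup.coe_mul, Subgroup.coe_inv, mul_inv, inv_inv]
    simp only [mul_assoc, mul_left_comm]
  have hinv : ∀ a e, c a ∈ D → n (a * e) = n e := by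
    intro a e ha
    refine (isInv_cell g).ncard_eq S.right ((isInv_cell g).inv S.right) ?_
    rw [map_mul, mul_assoc]
    exact h v hv hv1' e _ ha
  have hinvol : ∀ e, n (invol * e) = n e := fun e => hinv _ e hD.invol_mem
  have hsum := two_mul_add_eq hk hn hinvol
  have hpos := slice_card_pos (c := c) (Γ := Γ) g
  have hle : (slice c (cell Γ g) g).card ≤ 4 := Finset.card_le_univ _
  obtain ⟨k, hk_def⟩ : ∃ k, k = (slice c (cell Γ g) g).card := ⟨_, rfl⟩
  rw [← hk_def] at hk hsum hpos hle
  have heven : Even k := by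
    have : Even (Fintype.card S.core * (k * k)) := ⟨_, by rw [← hsum, two_mul]⟩
    simpa [Nat.even_mul, hVodd] using this
  obtain rfl | rfl : k = 4 ∨ k = 2 := by rw [Nat.even_iff] at heven; omega
  · intro d hd x hx
    obtain ⟨a, rfl⟩ := hD.le hd
    obtain ⟨⟨f, w⟩, rfl⟩ := S.cell_subset_range hU hg hx
    have huniv : E w = Finset.univ := Finset.eq_univ_of_card _ (hk w)
    have := mem_slice.1 (show a * f ∈ E w by rw [huniv]; exact Finset.mem_univ _)
    simpa [mul_assoc] using this
  · have hne : n 1 ≠ n (Multiplicative.ofAdd 1) := fun heq =>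
      hVodd (even_card_of_eq hk hn hinvol heq)
    rcases hD with ⟨rfl, hD⟩ | ⟨rfl, -⟩
    · have hstab : c invol ∈ cosetStab Γ S.right ⊥ isInv_bot := by
        intro y hy
        rcases mem_zpowers_invol.1 (hD.cell_subset (Subgroup.mem_zpowers _) hy) with rfl | rfl
        · have := isInv_one.cell_subset rfl (mem_cell_comm hy)
          exact absurd (S.map_eq_one this) (by decide)
        · simp
      by_cases hex : ∃ x ∈ cell Γ g, c invol * x ∈ cell Γ g
      · obtain ⟨t, ht, hct⟩ := hex
        intro d hd x hx
        rcases mem_zpowers_invol.1 hd with rfl | rfl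
        · rwa [one_mul]
        · rw [← cell_eq_of_mem ht] at hx
          have := mul_inv_mem_cell_of_mem_cosetStab_bot (inv_mem hstab) hx
          rwa [inv_inv, mul_comm x, mul_comm t, cell_eq_of_mem hct] at this
      · exfalso
        push Not at hex
        have hdisj : ∀ w, E w ∩ ({invol} * E w) = ∅ := by
          refine fun w => Finset.eq_empty_of_forall_notMem fun f hf => ?_
          rw [Finset.mem_inter, mem_singleton_mul_slice, mem_slice] at hf
          refine hex _ hf.2 ?_
          rw [← mul_assoc, ← map_mul, mul_inv_cancel_left]
          exact hf.1
        have h2 : n 1 + n invol = Fintype.card S.core * 2 := by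
          rw [hn, hn, ← Finset.sum_add_distrib,
            Finset.sum_congr rfl fun w _ => card_inter_add_card_inter _ _ (hk _) (hk _) (hdisj _)]
          simp
        have h3 := hinvol 1
        rw [mul_one] at h3
        omega
    · refine absurd (hinv (Multiplicative.ofAdd 1) 1 ⟨_, rfl⟩).symm ?_
      rwa [mul_one]

theorem hasWreath : HasWreath Γ := by
  by_cases hU : S.stab = ⊤
  · exact S.hasWreath_of_stab_eq_top hU
  by_cases hV : S.core ≤ cosetStab Γ S.right ⊥ isInv_bot
  · exact S.hasWreath_of_core_le hU hV
  obtain ⟨D, hD⟩ := exists_isLeast4 Γ c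
  have hcore : ∀ v ∈ S.core, v ≠ 1 → ∀ e, ∀ d ∈ D, ∀ x ∈ cell Γ (c e * v),
      d * x ∈ cell Γ (c e * v) := by
    intro v hv hv1 e
    refine (S.mul_mem_cell_or hD
      (mul_mem (S.range_le_stab ⟨e, rfl⟩) hv.1)).resolve_right fun h8 => hV fun w hw => ?_
    rw [map_mul_pow_eight] at h8
    obtain ⟨m, rfl⟩ := S.exists_pow_eq hU hv hv1 hw
    exact pow_mem (S.mem_of_pow_eight_mem hv.2 h8) m
  refine ⟨c.range, D, hD.le, S.isInv, hD.isInv S.isInv, S.ne_bot hD, ?_, ?_,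
    fun x hx y hy => hD.mul_inv_mem S.isInv hx hy⟩
  · exact fun h => hU (top_unique (h ▸ S.range_le_stab))
  · intro g hg
    by_cases hgU : g ∈ S.stab
    · obtain ⟨e, v, hv, rfl⟩ := S.exists_eq_of_mem_stab hgU
      exact hcore v hv (fun h => hg ⟨e, by rw [h, mul_one]⟩) e
    · exact S.mul_mem_cell_of_mul_mem_cell hU hD
        (fun v hv hv1 e d hd => hcore v hv hv1 e d hd _ (mem_cell_self _)) hgU

end Setting

end CoreCases

section Linking

variable {G : Type*} [CommGroup G] [Finite G] {Γ : Subgroup (Equiv.Perm G)}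

omit [CommGroup G] in
open Classical in
lemma coeff_sumElems [Group G] (X : Set G) (x : G) :
    (sumElems X).coeff x = if x ∈ X then 1 else 0 := by
  rw [sumElems, MonoidAlgebra.coeff_sum, Finsupp.finsetSum_apply]
  simp [Finsupp.single_apply]

lemma isASet_iff {A : SRing G} (hA : A.basic = Set.range (cell Γ)) {X : Set G} :
    A.IsASet X ↔ IsInv Γ X := by
  classical
  constructor
  · intro h
    have key : ∀ a ∈ A.span, ∀ x, ∀ y ∈ cell Γ x, a.coeff y = a.coeff x := by
      intro a ha
      induction ha using Submodule.span_induction with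
      | mem a ha =>
        obtain ⟨Y, hY, rfl⟩ := ha
        rw [hA] at hY
        obtain ⟨g, rfl⟩ := hY
        intro x y hy
        rw [coeff_sumElems, coeff_sumElems]
        congr 1
        exact propext ⟨fun h => (isInv_cell g).cell_subset h (mem_cell_comm hy),
          fun h => (isInv_cell g).cell_subset h hy⟩
      | zero => simp
      | add a b _ _ iha ihb =>
        intro x y hy
        simp [iha x y hy, ihb x y hy]
      | smul n a _ iha =>
        intro x y hy
        rw [MonoidAlgebra.coeff_smul, Finsupp.smul_apply, Finsupp.smul_apply, iha x y hy]
    refine isInv_of_cell_subset fun x hx y hy => ?_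
    have := key _ h x y hy
    rw [coeff_sumElems, coeff_sumElems, if_pos hx] at this
    by_contra hyX
    simp [hyX] at this
  · intro h
    rw [SRing.IsASet, sumElems, ← Finset.sum_fiberwise_of_maps_to (g := cell Γ)
      (t := X.toFinite.toFinset.image (cell Γ)) fun x hx => Finset.mem_image_of_mem _ hx]
    refine Submodule.sum_mem _ fun Y hY => ?_
    obtain ⟨g, hg, rfl⟩ := Finset.mem_image.1 hY
    rw [Set.Finite.mem_toFinset] at hg
    refine Submodule.subset_span ⟨cell Γ g, hA ▸ ⟨g, rfl⟩, ?_⟩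
    rw [sumElems]
    refine Finset.sum_congr ?_ fun _ _ => rfl
    ext x
    rw [Finset.mem_filter, Set.Finite.mem_toFinset, Set.Finite.mem_toFinset]
    exact ⟨fun hx => ⟨h.cell_subset hg hx, cell_eq_of_mem hx⟩,
      fun hx => hx.2 ▸ mem_cell_self x⟩

lemma wreathConclusion_of_hasWreath {A : SRing G} (hA : A.basic = Set.range (cell Γ)) (p : ℕ)
    (h : HasWreath Γ) : WreathConclusion p A := by
  obtain ⟨U, L, hLU, hUinv, hLinv, hL, hU, hrad, hsec⟩ := h
  refine ⟨U, L, hLU, (isASet_iff hA).2 hUinv, (isASet_iff hA).2 hLinv, hL, hU, ?_, Or.inl ?_⟩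
  · intro X hX hXU l hl
    rw [hA] at hX
    obtain ⟨g, rfl⟩ := hX
    have hg : g ∉ U := fun hg => hXU (hUinv.cell_subset hg)
    have heq : {l} * cell Γ g = cell Γ g := by
      refine Set.Subset.antisymm ?_ fun x hx => ?_
      · rintro _ ⟨_, rfl, x, hx, rfl⟩
        exact hrad g hg _ hl x hx
      · exact ⟨l, rfl, l⁻¹ * x, hrad g hg _ (inv_mem hl) x hx, mul_inv_cancel_left _ _⟩
    exact ⟨heq, by rwa [mul_comm]⟩
  · intro AS hAS
    rw [hAS]
    have key : ∀ x : U, QuotientGroup.mk '' (Subtype.val ⁻¹' cell Γ (x : G) : Set U) =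
        ({QuotientGroup.mk x} : Set (U ⧸ L.subgroupOf U)) := by
      intro x
      refine Set.Subset.antisymm ?_ ?_
      · rintro _ ⟨y, hy, rfl⟩
        exact Set.mem_singleton_iff.2 (QuotientGroup.eq.2
          (show x⁻¹ * y ∈ L.subgroupOf U from hsec x x.2 y hy)).symm
      · rintro _ rfl
        exact ⟨x, mem_cell_self _, rfl⟩
    ext Z
    constructor
    · rintro ⟨X, hX, hXU, rfl⟩
      rw [hA] at hX
      obtain ⟨g, rfl⟩ := hX
      exact ⟨_, (key ⟨g, hXU (mem_cell_self g)⟩).symm⟩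
    · rintro ⟨⟨x⟩, rfl⟩
      exact ⟨cell Γ (x : G), hA ▸ ⟨_, rfl⟩, hUinv.cell_subset x.2, (key x).symm⟩

end Linking

/-- In the setting of the classification over `C₄ × C_p × C_p`,
if `C` is an `𝒜`-subgroup but `H` is not, then `𝒜` is a nontrivial `S = U/L`-wreath
product satisfying one of (CA), (CA'), (CA''). -/
theorem stmt14 (p : ℕ) (hp : p.Prime) (hodd : Odd p)
    (G : Type*) [CommGroup G] [Finite G] (C H : Subgroup G)
    (hC : Nonempty (↥C ≃* Multiplicative (ZMod 4)))
    (hH : Nonempty (↥H ≃* Multiplicative (ZMod p) × Multiplicative (ZMod p)))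
    (hinf : C ⊓ H = ⊥) (hsup : C ⊔ H = ⊤)
    (K : Subgroup (Equiv.Perm G)) (hK : InSup2Min K)
    (A : SRing G) (hA : A.basic = VBasic K)
    (hCA : A.IsASubgroup C) (hHA : ¬ A.IsASubgroup H) :
    WreathConclusion p A := by
  have := Fact.mk hp
  obtain ⟨e⟩ := hC
  obtain ⟨f⟩ := hH
  have hAK : A.basic = Set.range (cell K) := by rw [hA, VBasic_eq_range_cell]
  have hcardH : Nat.card H = p ^ 2 := by
    rw [Nat.card_congr f.toEquiv, Nat.card_prod, pow_two]
    exact congrArg₂ _ (Nat.card_zmod p) (Nat.card_zmod p)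
  have hindex : Nat.card (G ⧸ C) = p ^ 2 := by
    rw [← hcardH]
    refine (Subgroup.isComplement'_of_disjoint_and_mul_eq_univ
      (disjoint_iff.2 (inf_comm C H ▸ hinf)) ?_).index_eq_card
    rw [← Subgroup.mul_normal, sup_comm, hsup, Subgroup.coe_top]
  obtain ⟨Γ, hΓ, hCΓ, hcell, hP⟩ :=
    hK.exists_isPGroup_quotPerm ((isASet_iff hAK).1 hCA) hindex
  rw [← hcell] at hAK
  obtain ⟨c, hc, rfl⟩ : ∃ c : Multiplicative (ZMod 4) →* G, Function.Injective c ∧ c.range = C :=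
    ⟨C.subtype.comp e.symm.toMonoidHom, C.subtype_injective.comp e.symm.injective, by
      rw [MonoidHom.range_comp, MonoidHom.range_eq_top.2 e.symm.surjective,
        ← MonoidHom.range_eq_map, Subgroup.range_subtype]⟩
  refine wreathConclusion_of_hasWreath hAK p (Setting.hasWreath (p := p) (c := c) (H := H) ?_)
  refine ⟨hp, hodd, hΓ, hCΓ, hP, hc, ?_, ?_, ?_, hcardH, fun h => hHA ((isASet_iff hAK).2 h)⟩
  · intro a ha
    have : c a ∈ c.range ⊓ H := ⟨⟨a, rfl⟩, ha⟩
    rw [hinf, Subgroup.mem_bot] at this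
    exact hc (this.trans (map_one c).symm)
  · intro x
    obtain ⟨_, ⟨a, rfl⟩, h, hh, rfl⟩ := Subgroup.mem_sup.1 (hsup ▸ Subgroup.mem_top x)
    exact ⟨a, h, hh, rfl⟩
  · intro h hh
    have key : ∀ a : Multiplicative (ZMod p), a ^ p = 1 := fun a => by
      have := pow_card_eq_one' (x := a)
      rwa [show Nat.card (Multiplicative (ZMod p)) = p from Nat.card_zmod p] at this
    have h1 : f ⟨h, hh⟩ ^ p = 1 := Prod.ext (key _) (key _)
    rw [← map_pow, map_eq_one_iff f f.injective] at h1
    exact congrArg Subtype.val h1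

end Paper
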